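/- arXiv:1910.06893 — 5 statements merged into one kernel-verified Lean document; each statement's English description precedes it below -/
import Mathlib

section
/- Let p and q be continuously differentiable, strictly positive probability densities on ℝⁿ with finite Fisher information J(p) and J(q). Then for every λ ∈ (0,1), the Fisher information is convex: J(λp + (1-λ)q) ≤ λ J(p) + (1-λ) J(q). -/
open MeasureTheory Real

/-- The perspective function `(v, s) ↦ ‖v‖ ^ 2 / s` is jointly convex on `s > 0`. -/
theorem norm_sq_div_convex {E : Type*} [SeminormedAddCommGroup E] [NormedSpace ℝ E]
    (u v : E) {s t a b : ℝ} (hs : 0 < s) (ht : 0 < t) (ha : 0 < a) (hb : 0 < b) :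
    ‖a • u + b • v‖ ^ 2 / (a * s + b * t) ≤ a * (‖u‖ ^ 2 / s) + b * (‖v‖ ^ 2 / t) := by
  have hst : 0 < a * s + b * t := by positivity
  have hnorm : ‖a • u + b • v‖ ≤ a * ‖u‖ + b * ‖v‖ := by
    simpa [norm_smul, abs_of_pos ha, abs_of_pos hb] using norm_add_le (a • u) (b • v)
  have hgap : a * (‖u‖ ^ 2 / s) + b * (‖v‖ ^ 2 / t) - (a * ‖u‖ + b * ‖v‖) ^ 2 / (a * s + b * t)
      = a * b * (‖u‖ * t - ‖v‖ * s) ^ 2 / (s * t * (a * s + b * t)) := by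
    field_simp
    ring
  have hgap_nonneg : 0 ≤ a * b * (‖u‖ * t - ‖v‖ * s) ^ 2 / (s * t * (a * s + b * t)) := by
    positivity
  calc ‖a • u + b • v‖ ^ 2 / (a * s + b * t)
      ≤ (a * ‖u‖ + b * ‖v‖) ^ 2 / (a * s + b * t) := by gcongr
    _ ≤ a * (‖u‖ ^ 2 / s) + b * (‖v‖ ^ 2 / t) := by linarith

theorem gradient_const_mul_add_const_mul {E : Type*} [NormedAddCommGroup E]
    [InnerProductSpace ℝ E] [CompleteSpace E] {f g : E → ℝ} {x : E}
    (hf : DifferentiableAt ℝ f x) (hg : DifferentiableAt ℝ g x) (a b : ℝ) :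
    gradient (fun y => a * f y + b * g y) x = a • gradient f x + b • gradient g x := by
  simp only [gradient]
  rw [fderiv_fun_add (hf.const_mul a) (hg.const_mul b), fderiv_const_mul hf,
    fderiv_const_mul hg]
  simp

/-- Convexity of the Fisher information
`J(p) = ∫ ‖∇p(x)‖²/p(x) dx`: for continuously differentiable strictly positive
probability densities `p, q` on `ℝⁿ` with finite Fisher information and `λ ∈ (0,1)`,
`J(λp + (1-λ)q) ≤ λ J(p) + (1-λ) J(q)`. -/
theorem fisher_information_convex
    (n : ℕ) (p q : EuclideanSpace ℝ (Fin n) → ℝ)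
    (hp : ContDiff ℝ 1 p) (hq : ContDiff ℝ 1 q)
    (hppos : ∀ x, 0 < p x) (hqpos : ∀ x, 0 < q x)
    (hpint : (∫ x, p x) = 1) (hqint : (∫ x, q x) = 1)
    (hJp : Integrable (fun x => ‖gradient p x‖ ^ 2 / p x))
    (hJq : Integrable (fun x => ‖gradient q x‖ ^ 2 / q x))
    (lam : ℝ) (hlam : lam ∈ Set.Ioo (0 : ℝ) 1) :
    (∫ x, ‖gradient (fun y => lam * p y + (1 - lam) * q y) x‖ ^ 2
        / (lam * p x + (1 - lam) * q x))
      ≤ lam * (∫ x, ‖gradient p x‖ ^ 2 / p x)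
        + (1 - lam) * ∫ x, ‖gradient q x‖ ^ 2 / q x := by
  have ha : 0 < lam := hlam.1
  have hb : 0 < 1 - lam := sub_pos.mpr hlam.2
  rw [← integral_const_mul, ← integral_const_mul,
    ← integral_add (hJp.const_mul lam) (hJq.const_mul (1 - lam))]
  refine integral_mono_of_nonneg (.of_forall fun x => ?_)
    ((hJp.const_mul lam).add (hJq.const_mul (1 - lam))) (.of_forall fun x => ?_)
  · have hpx := hppos x
    have hqx := hqpos x
    dsimp only [Pi.zero_apply]
    positivity
  · dsimp only
    rw [gradient_const_mul_add_const_mul (hp.differentiable one_ne_zero x)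
      (hq.differentiable one_ne_zero x)]
    exact norm_sq_div_convex _ _ (hppos x) (hqpos x) ha hb
end

section
/- Fix a real p×k matrix C. The map H ↦ log det(I_k + Cᵀ H⁻¹ C) is convex on the set of p×p real symmetric positive definite matrices: for positive definite H₁, H₂ and λ ∈ [0,1], log det(I + Cᵀ (λH₁ + (1-λ)H₂)⁻¹ C) ≤ λ log det(I + Cᵀ H₁⁻¹ C) + (1-λ) log det(I + Cᵀ H₂⁻¹ C). -/
open Matrix

namespace Matrix

variable {n : Type*}

lemma PosDef.convexComb {A B : Matrix n n ℝ} (hA : A.PosDef) (hB : B.PosDef) {a b : ℝ}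
    (ha : 0 ≤ a) (hb : 0 ≤ b) (hab : a + b = 1) : (a • A + b • B).PosDef := by
  rcases ha.eq_or_lt with rfl | ha
  · obtain rfl : b = 1 := by linarith
    simpa using hB
  · exact (hA.smul ha).add_posSemidef (hB.posSemidef.smul hb)

lemma PosDef.add_vecMulVec_self [Finite n] {K : Matrix n n ℝ} (hK : K.PosDef) (v : n → ℝ) :
    (K + vecMulVec v v).PosDef :=
  hK.add_posSemidef (by simpa using posSemidef_vecMulVec_self_star v)

variable [Fintype n] [DecidableEq n]

lemma PosDef.two_mul_dotProduct_sub_le {L : Matrix n n ℝ} (hL : L.PosDef) (v x : n → ℝ) :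
    2 * (v ⬝ᵥ x) - x ⬝ᵥ (L *ᵥ x) ≤ v ⬝ᵥ (L⁻¹ *ᵥ v) := by
  have hdet : IsUnit L.det := hL.det_pos.ne'.isUnit
  have hLy : L *ᵥ (L⁻¹ *ᵥ v) = v := by
    rw [mulVec_mulVec, mul_nonsing_inv _ hdet, one_mulVec]
  have hsymm : (L⁻¹ *ᵥ v) ⬝ᵥ (L *ᵥ x) = v ⬝ᵥ x := by
    have hT : Lᵀ = L := by simpa using hL.isHermitian.eq
    rw [dotProduct_mulVec, ← mulVec_transpose, hT, hLy]
  have h := hL.posSemidef.dotProduct_mulVec_nonneg (x - L⁻¹ *ᵥ v)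
  simp only [star_trivial, mulVec_sub, hLy, sub_dotProduct, dotProduct_sub, hsymm] at h
  rw [dotProduct_comm x v, dotProduct_comm (L⁻¹ *ᵥ v) v] at h
  linarith

lemma PosDef.dotProduct_inv_mulVec_convex {A B : Matrix n n ℝ} (hA : A.PosDef) (hB : B.PosDef)
    {a b : ℝ} (ha : 0 ≤ a) (hb : 0 ≤ b) (hab : a + b = 1) (v : n → ℝ) :
    v ⬝ᵥ ((a • A + b • B)⁻¹ *ᵥ v) ≤ a * (v ⬝ᵥ (A⁻¹ *ᵥ v)) + b * (v ⬝ᵥ (B⁻¹ *ᵥ v)) := by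
  have hL := hA.convexComb hB ha hb hab
  have hLx : (a • A + b • B) *ᵥ ((a • A + b • B)⁻¹ *ᵥ v) = v := by
    rw [mulVec_mulVec, mul_nonsing_inv _ hL.det_pos.ne'.isUnit, one_mulVec]
  set x := (a • A + b • B)⁻¹ *ᵥ v
  have hquad : a * (x ⬝ᵥ (A *ᵥ x)) + b * (x ⬝ᵥ (B *ᵥ x)) = v ⬝ᵥ x := by
    rw [← dotProduct_comm x v, ← congrArg (x ⬝ᵥ ·) hLx]
    simp [add_mulVec, smul_mulVec, dotProduct_add, dotProduct_smul]
  have h₁ := mul_le_mul_of_nonneg_left (hA.two_mul_dotProduct_sub_le v x) ha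
  have h₂ := mul_le_mul_of_nonneg_left (hB.two_mul_dotProduct_sub_le v x) hb
  obtain rfl : b = 1 - a := by linarith
  linarith

lemma PosDef.one_sub_dotProduct_inv_add_vecMulVec {K : Matrix n n ℝ} (hK : K.PosDef)
    (v : n → ℝ) : 1 - v ⬝ᵥ ((K + vecMulVec v v)⁻¹ *ᵥ v) = K.det / (K + vecMulVec v v).det := by
  have hL := (hK.add_vecMulVec_self v).det_pos
  rw [eq_div_iff hL.ne', mul_comm]
  have h := det_add_replicateCol_mul_replicateRow (ι := Unit) hL.ne'.isUnit (-v) v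
  rw [← vecMulVec_eq, neg_vecMulVec, add_neg_cancel_right] at h
  have hquad : (replicateRow Unit v * (K + vecMulVec v v)⁻¹ * replicateCol Unit (-v)) () () =
      -(v ⬝ᵥ ((K + vecMulVec v v)⁻¹ *ᵥ v)) := by
    rw [← dotProduct_neg, ← mulVec_neg, Matrix.mul_assoc]
    rfl
  rw [h, det_unique (n := Unit), sub_eq_add_neg, ← hquad]
  rfl

/-- The increment of `log det` under a fixed rank-one update is convex. -/
lemma PosDef.log_det_add_vecMulVec_sub_convex {A B : Matrix n n ℝ} (hA : A.PosDef)
    (hB : B.PosDef) {a b : ℝ} (ha : 0 ≤ a) (hb : 0 ≤ b) (hab : a + b = 1) (v : n → ℝ) :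
    Real.log (a • A + b • B + vecMulVec v v).det - Real.log (a • A + b • B).det ≤
      a * (Real.log (A + vecMulVec v v).det - Real.log A.det) +
        b * (Real.log (B + vecMulVec v v).det - Real.log B.det) := by
  have key {K : Matrix n n ℝ} (hK : K.PosDef) :
      0 < 1 - v ⬝ᵥ ((K + vecMulVec v v)⁻¹ *ᵥ v) ∧
      Real.log (K + vecMulVec v v).det - Real.log K.det =
        -Real.log (1 - v ⬝ᵥ ((K + vecMulVec v v)⁻¹ *ᵥ v)) := by
    have hL := (hK.add_vecMulVec_self v).det_pos
    rw [hK.one_sub_dotProduct_inv_add_vecMulVec, Real.log_div hK.det_pos.ne' hL.ne']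
    exact ⟨div_pos hK.det_pos hL, by ring⟩
  obtain ⟨pA, eA⟩ := key hA
  obtain ⟨pB, eB⟩ := key hB
  obtain ⟨-, e⟩ := key (hA.convexComb hB ha hb hab)
  have hcomb : a • A + b • B + vecMulVec v v =
      a • (A + vecMulVec v v) + b • (B + vecMulVec v v) := by
    rw [smul_add, smul_add, add_add_add_comm, ← add_smul, hab, one_smul]
  have hconv := (hA.add_vecMulVec_self v).dotProduct_inv_mulVec_convex
    (hB.add_vecMulVec_self v) ha hb hab v
  have hlog := strictConcaveOn_log_Ioi.concaveOn.2 pA pB ha hb hab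
  have hpos := (convex_Ioi (0 : ℝ)) pA pB ha hb hab
  simp only [smul_eq_mul, Set.mem_Ioi] at hlog hpos
  rw [e, eA, eB, hcomb]
  have := Real.log_le_log hpos (show _ ≤ 1 - v ⬝ᵥ
    ((a • (A + vecMulVec v v) + b • (B + vecMulVec v v))⁻¹ *ᵥ v) by linarith)
  linarith

/-- The increment of `log det` under a fixed update by a sum of rank-one matrices is convex. -/
lemma PosDef.log_det_add_sum_vecMulVec_sub_convex {ι : Type*} (c : ι → n → ℝ) (s : Finset ι)
    {A B : Matrix n n ℝ} (hA : A.PosDef) (hB : B.PosDef) {a b : ℝ} (ha : 0 ≤ a) (hb : 0 ≤ b)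
    (hab : a + b = 1) :
    Real.log (a • A + b • B + ∑ i ∈ s, vecMulVec (c i) (c i)).det -
        Real.log (a • A + b • B).det ≤
      a * (Real.log (A + ∑ i ∈ s, vecMulVec (c i) (c i)).det - Real.log A.det) +
        b * (Real.log (B + ∑ i ∈ s, vecMulVec (c i) (c i)).det - Real.log B.det) := by
  classical
  induction s using Finset.induction_on generalizing A B with
  | empty => simp
  | insert i s hi ih =>
    have hstep := hA.log_det_add_vecMulVec_sub_convex hB ha hb hab (c i)
    have hrest := ih (hA.add_vecMulVec_self (c i)) (hB.add_vecMulVec_self (c i))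
    have hcomb : a • (A + vecMulVec (c i) (c i)) + b • (B + vecMulVec (c i) (c i)) =
        a • A + b • B + vecMulVec (c i) (c i) := by
      rw [smul_add, smul_add, add_add_add_comm, ← add_smul, hab, one_smul]
    rw [hcomb] at hrest
    simp only [Finset.sum_insert hi, ← add_assoc]
    linarith

lemma PosDef.log_det_one_add_transpose_mul_inv_mul {m : Type*} [Fintype m] [DecidableEq m]
    {H : Matrix n n ℝ} (hH : H.PosDef) (C : Matrix n m ℝ) :
    Real.log (1 + Cᵀ * H⁻¹ * C).det =
      Real.log (H + ∑ j, vecMulVec (Cᵀ j) (Cᵀ j)).det - Real.log H.det := by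
  have hsum : ∑ j, vecMulVec (Cᵀ j) (Cᵀ j) = C * Cᵀ := by
    ext i j
    simp [mul_apply, sum_apply, vecMulVec_apply]
  have hpos : 0 < (H + C * Cᵀ).det :=
    (hH.add_posSemidef (by simpa using posSemidef_self_mul_conjTranspose C)).det_pos
  have hdet := det_add_mul C Cᵀ hH.det_pos.ne'.isUnit
  rw [hsum, ← Real.log_div hpos.ne' hH.det_pos.ne', hdet, mul_div_cancel_left₀ _ hH.det_pos.ne']

end Matrix

/-- Convexity of `H ↦ log det(I + Cᵀ H⁻¹ C)` on symmetric positive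
definite matrices: for positive definite `H₁, H₂` and `λ ∈ [0,1]`,
`log det(I + Cᵀ(λH₁+(1-λ)H₂)⁻¹C) ≤ λ log det(I + CᵀH₁⁻¹C) + (1-λ) log det(I + CᵀH₂⁻¹C)`. -/
theorem logdet_inv_convex
    (p k : ℕ) (C : Matrix (Fin p) (Fin k) ℝ)
    (H₁ H₂ : Matrix (Fin p) (Fin p) ℝ) (h1 : H₁.PosDef) (h2 : H₂.PosDef)
    (lam : ℝ) (hlam : lam ∈ Set.Icc (0 : ℝ) 1) :
    Real.log ((1 + Cᵀ * (lam • H₁ + (1 - lam) • H₂)⁻¹ * C).det)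
      ≤ lam * Real.log ((1 + Cᵀ * H₁⁻¹ * C).det)
        + (1 - lam) * Real.log ((1 + Cᵀ * H₂⁻¹ * C).det) := by
  have hlam₁ : 0 ≤ 1 - lam := sub_nonneg.mpr hlam.2
  have hsum : lam + (1 - lam) = 1 := by ring
  rw [(h1.convexComb h2 hlam.1 hlam₁ hsum).log_det_one_add_transpose_mul_inv_mul,
    h1.log_det_one_add_transpose_mul_inv_mul, h2.log_det_one_add_transpose_mul_inv_mul]
  exact h1.log_det_add_sum_vecMulVec_sub_convex _ _ h2 hlam.1 hlam₁ hsum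
end

section
/- Let D be a real symmetric p×p matrix, and let V be a real p×k matrix with orthonormal columns (VᵀV = I_k), where k ≤ p. Then for every 1 ≤ j ≤ k, the sum of the j largest eigenvalues of the k×k symmetric matrix VᵀDV is at most the sum of the j largest eigenvalues of D. In particular, the decreasingly ordered eigenvalue vector of VᵀDV is weakly majorized by the vector of the k largest eigenvalues of D in decreasing order. -/
open Matrix Finset

/-- A finite real family has a `j`-element set of indices carrying its `j` largest values, and
the sum over it dominates every combination with weights in `[0, 1]` of total weight `j`. -/
theorem exists_card_eq_sum_mul_le_sum {ι : Type*} [Fintype ι] [DecidableEq ι]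
    (a w : ι → ℝ) (j : ℕ) (hj : 1 ≤ j) (hw0 : ∀ i, 0 ≤ w i) (hw1 : ∀ i, w i ≤ 1)
    (hw : ∑ i, w i = j) :
    ∃ t : Finset ι, t.card = j ∧ ∑ i, w i * a i ≤ ∑ i ∈ t, a i := by
  have hcard : j ≤ (univ : Finset ι).card := by
    have h : ∑ i, w i ≤ ∑ _i : ι, (1 : ℝ) := sum_le_sum fun i _ => hw1 i
    rw [hw] at h
    simpa using h
  obtain ⟨t, ht, hmax⟩ := exists_max_image (powersetCard j (univ : Finset ι))
    (fun t => ∑ i ∈ t, a i) (powersetCard_nonempty.2 hcard)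
  have htc : t.card = j := (mem_powersetCard.1 ht).2
  have hswap : ∀ i ∈ t, ∀ l ∉ t, a l ≤ a i := by
    intro i hi l hl
    have hl' : l ∉ t.erase i := fun h => hl (mem_of_mem_erase h)
    have h := hmax (insert l (t.erase i)) (mem_powersetCard.2 ⟨subset_univ _, by
      rw [card_insert_of_notMem hl', card_erase_of_mem hi]; omega⟩)
    rw [sum_insert hl', ← add_sum_erase t a hi] at h
    linarith
  obtain ⟨m, hm, hmin⟩ := exists_min_image t a (card_pos.1 (by omega))
  refine ⟨t, htc, ?_⟩
  have hnonneg : 0 ≤ ∑ i, ((if i ∈ t then 1 else 0) - w i) * (a i - a m) := by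
    refine sum_nonneg fun i _ => ?_
    split_ifs with hi
    · exact mul_nonneg (sub_nonneg.2 (hw1 i)) (sub_nonneg.2 (hmin i hi))
    · exact mul_nonneg_of_nonpos_of_nonpos (by linarith [hw0 i])
        (sub_nonpos.2 (hswap m hm i hi))
  have hexpand : ∑ i, ((if i ∈ t then 1 else 0) - w i) * (a i - a m)
      = ∑ i ∈ t, a i - ∑ i, w i * a i - a m * (t.card - ∑ i, w i) := by
    simp only [mul_sub, sub_mul, sum_sub_distrib, ← sum_mul, ite_mul, one_mul, zero_mul,
      sum_ite_mem, univ_inter, sum_const, nsmul_eq_mul]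
    ring
  rw [hexpand, hw, htc] at hnonneg
  linarith

/-- The rows of a real matrix with orthonormal columns have norm at most one. -/
theorem sum_row_sq_le_one_of_transpose_mul_self_eq_one {m n : Type*} [Fintype m] [Fintype n]
    [DecidableEq n] (W : Matrix m n ℝ) (hW : Wᵀ * W = 1) (l : m) :
    ∑ i, W l i ^ 2 ≤ 1 := by
  have hP : (W * Wᵀ) * (W * Wᵀ)ᵀ = W * Wᵀ := by
    rw [transpose_mul, transpose_transpose, Matrix.mul_assoc, ← Matrix.mul_assoc Wᵀ, hW,
      Matrix.one_mul]
  have hdiag : (W * Wᵀ) l l = ∑ i, W l i ^ 2 := by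
    simp [Matrix.mul_apply, sq]
  have hsq : (W * Wᵀ) l l ^ 2 ≤ (W * Wᵀ) l l := by
    conv_rhs => rw [← hP, Matrix.mul_apply]
    simp only [transpose_apply (W * Wᵀ), ← sq]
    exact single_le_sum (f := fun x => (W * Wᵀ) l x ^ 2) (fun x _ => sq_nonneg _) (mem_univ l)
  rw [hdiag] at hsq
  nlinarith

/-- The spectral theorem for a real symmetric matrix, with the orthogonal matrix explicit. -/
theorem exists_orthogonal_transpose_mul_mul_eq_diagonal {n : Type*} [Fintype n] [DecidableEq n]
    (A : Matrix n n ℝ) (hA : A.IsHermitian) :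
    ∃ U : Matrix n n ℝ, Uᵀ * U = 1 ∧ U * Uᵀ = 1 ∧ Uᵀ * A * U = diagonal hA.eigenvalues := by
  have hstar : star (hA.eigenvectorUnitary : Matrix n n ℝ)
      = (hA.eigenvectorUnitary : Matrix n n ℝ)ᵀ := by
    rw [star_eq_conjTranspose, conjTranspose_eq_transpose_of_trivial]
  refine ⟨hA.eigenvectorUnitary, ?_, ?_, ?_⟩
  · rw [← hstar]
    exact Unitary.coe_star_mul_self _
  · rw [← hstar]
    exact Unitary.coe_mul_star_self _
  · have h := hA.conjStarAlgAut_star_eigenvectorUnitary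
    rw [Unitary.conjStarAlgAut_star_apply] at h
    simpa [hstar, Function.comp_def] using h

/-- Ky Fan-type majorization for compressions: if `D` is real
symmetric `p×p` and `V` is `p×k` with orthonormal columns (`VᵀV = I`), `k ≤ p`, then for
every `1 ≤ j ≤ k` the sum of any `j` eigenvalues of `VᵀDV` is bounded by the sum of some
`j` eigenvalues of `D`; i.e. the sum of the `j` largest eigenvalues of `VᵀDV` is at most
the sum of the `j` largest eigenvalues of `D` (the decreasingly ordered spectrum of
`VᵀDV` is weakly majorized by the `k` largest eigenvalues of `D`). -/
theorem eigenvalue_sum_compression_le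
    (p k : ℕ) (hk : k ≤ p)
    (D : Matrix (Fin p) (Fin p) ℝ) (hD : D.IsHermitian)
    (V : Matrix (Fin p) (Fin k) ℝ) (hV : Vᵀ * V = 1)
    (hDV : (Vᵀ * D * V).IsHermitian) :
    ∀ j, 1 ≤ j → j ≤ k → ∀ s : Finset (Fin k), s.card = j →
      ∃ t : Finset (Fin p), t.card = j ∧
        (∑ i ∈ s, hDV.eigenvalues i) ≤ ∑ i ∈ t, hD.eigenvalues i := by
  intro j hj _ s hs
  obtain ⟨U, hU, hU', hUD⟩ := exists_orthogonal_transpose_mul_mul_eq_diagonal D hD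
  obtain ⟨Q, hQ, -, hQD⟩ := exists_orthogonal_transpose_mul_mul_eq_diagonal _ hDV
  set W : Matrix (Fin p) (Fin k) ℝ := Uᵀ * V * Q with hWdef
  have hcancel : ∀ {n : ℕ} (X : Matrix (Fin p) (Fin n) ℝ), U * (Uᵀ * X) = X := fun X => by
    rw [← Matrix.mul_assoc, hU', Matrix.one_mul]
  have hW : Wᵀ * W = 1 := by
    simp only [hWdef, transpose_mul, transpose_transpose, Matrix.mul_assoc, hcancel]
    rw [← Matrix.mul_assoc Vᵀ, hV, Matrix.one_mul, hQ]
  have hWD : Wᵀ * diagonal hD.eigenvalues * W = diagonal hDV.eigenvalues := by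
    rw [← hUD, ← hQD]
    simp only [hWdef, transpose_mul, transpose_transpose, Matrix.mul_assoc, hcancel]
  have hcol : ∀ i, ∑ l, W l i ^ 2 = 1 := fun i => by
    have h := congrFun (congrFun hW i) i
    simpa [Matrix.mul_apply, sq] using h
  have heig : ∀ i, hDV.eigenvalues i = ∑ l, W l i ^ 2 * hD.eigenvalues l := fun i => by
    have h := congrFun (congrFun hWD i) i
    rw [diagonal_apply_eq, Matrix.mul_apply] at h
    rw [← h]
    refine sum_congr rfl fun l _ => ?_
    rw [mul_diagonal, transpose_apply]
    ring
  obtain ⟨t, ht, hle⟩ := exists_card_eq_sum_mul_le_sum hD.eigenvalues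
    (fun l => ∑ i ∈ s, W l i ^ 2) j hj (fun l => sum_nonneg fun i _ => sq_nonneg _)
    (fun l => (sum_le_univ_sum_of_nonneg fun i => sq_nonneg (W l i)).trans
      (sum_row_sq_le_one_of_transpose_mul_self_eq_one W hW l))
    (by rw [sum_comm]; simp [hcol, hs])
  refine ⟨t, ht, le_trans (le_of_eq ?_) hle⟩
  simp only [heig, sum_mul]
  exact sum_comm
end

section
/- Let σ > 0, β > 0, and let Σ_xy ∈ ℝ^{p×m}, with Σ_yx = Σ_xyᵀ. Suppose the p×p positive semidefinite matrix Σ_xy Σ_yx has exactly k nonzero eigenvalues 0 < λ₁ ≤ ⋯ ≤ λ_k, with corresponding orthonormal eigenvectors forming the columns of U ∈ ℝ^{p×k}. Define d_i = √(λ_i/β) - 1 if λ_i ≥ β and d_i = 0 otherwise, let D = diag(d₁, …, d_k), and set A* = (1/σ) D^{1/2} Uᵀ ∈ ℝ^{k×p}. Then A* minimizes the objective G(A) = -tr( Σ_yx Aᵀ (σ² A Aᵀ + I)⁻¹ A Σ_xy ) + β tr(Aᵀ A) over all matrices A ∈ ℝ^{k×p}; i.e., G(A) ≥ G(A*) for every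 A ∈ ℝ^{k×p}. (This objective is, up to an additive constant, the robust information bottleneck objective mmse(Y|T) + β Φ(T|X) for jointly Gaussian (X,Y) with Cov(X) = σ²I_p and cross-covariance Σ_xy, over Gaussian features T = AX + ε with ε ~ N(0, I_k).) -/
open Matrix

namespace Matrix

section General

variable {n m k : Type*} [Fintype n] [Fintype m] [Fintype k] [DecidableEq k]

/-- A symmetric matrix whose rank is the number of given orthonormal eigenvectors with nonzero
eigenvalues is diagonalized by them. -/
theorem eq_mul_diagonal_mul_transpose_of_rank_eq [DecidableEq n] {M : Matrix n n ℝ}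
    {U : Matrix n k ℝ} {lam : k → ℝ} (hM : Mᵀ = M) (hlam : ∀ i, lam i ≠ 0) (hU : Uᵀ * U = 1)
    (heig : M * U = U * diagonal lam) (hrank : M.rank = Fintype.card k) :
    M = U * diagonal lam * Uᵀ := by
  have hU_eq : U = M * (U * diagonal (fun i => (lam i)⁻¹)) := by
    rw [← Matrix.mul_assoc, heig, Matrix.mul_assoc, diagonal_mul_diagonal]
    simp [hlam]
  have hU_rank : U.rank = Fintype.card k := by
    refine le_antisymm (rank_le_card_width U) ?_
    have h := rank_mul_le_right Uᵀ U
    rwa [hU, rank_one] at h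
  have hle : LinearMap.range U.mulVecLin ≤ LinearMap.range M.mulVecLin := by
    rintro _ ⟨v, rfl⟩
    refine ⟨(U * diagonal (fun i => (lam i)⁻¹)) *ᵥ v, ?_⟩
    rw [mulVecLin_apply, mulVecLin_apply, mulVec_mulVec, ← hU_eq]
  have hrange : LinearMap.range U.mulVecLin = LinearMap.range M.mulVecLin :=
    Submodule.eq_of_le_of_finrank_eq hle (hU_rank.trans hrank.symm)
  have hproj : U * Uᵀ * M = M := by
    refine ext_of_mulVec_single fun i => ?_
    obtain ⟨w, hw⟩ : M *ᵥ Pi.single i 1 ∈ LinearMap.range U.mulVecLin := by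
      rw [hrange]
      exact ⟨_, rfl⟩
    rw [mulVecLin_apply] at hw
    rw [← mulVec_mulVec, ← hw, mulVec_mulVec, Matrix.mul_assoc, hU, Matrix.mul_one]
  have h := congrArg transpose hproj
  simp only [transpose_mul, transpose_transpose, hM] at h
  rw [← Matrix.mul_assoc, heig] at h
  exact h.symm

theorem posDef_mul_transpose_self_add_one (B : Matrix k n ℝ) : (B * Bᵀ + 1).PosDef := by
  have h := posSemidef_self_mul_conjTranspose B
  rw [conjTranspose_eq_transpose_of_trivial] at h
  exact PosDef.posSemidef_add h PosDef.one

theorem transpose_mul_inv_mul_eq_one_sub_inv [DecidableEq n] (B : Matrix k n ℝ) :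
    Bᵀ * (B * Bᵀ + 1)⁻¹ * B = 1 - (Bᵀ * B + 1)⁻¹ := by
  have hdet := (isUnit_iff_isUnit_det _).1 (posDef_mul_transpose_self_add_one B).isUnit
  have h : (Bᵀ * B + 1) * (1 - Bᵀ * (B * Bᵀ + 1)⁻¹ * B) = 1 := by
    have h1 : (Bᵀ * B + 1) * (Bᵀ * (B * Bᵀ + 1)⁻¹ * B)
        = Bᵀ * ((B * Bᵀ + 1) * (B * Bᵀ + 1)⁻¹) * B := by
      simp only [Matrix.add_mul, Matrix.mul_add, Matrix.one_mul, Matrix.mul_assoc]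
    rw [Matrix.mul_sub, h1, mul_nonsing_inv _ hdet, Matrix.mul_one, Matrix.mul_one]
    abel
  rw [inv_eq_right_inv h]
  abel

/-- The trace function `X ↦ tr (Sᵀ X⁻¹ S)` lies above its tangent at `Z⁻¹`. -/
theorem PosDef.two_mul_trace_sub_le_trace_inv [DecidableEq n] {X Z : Matrix n n ℝ} (hX : X.PosDef)
    (hZ : Zᵀ = Z) (S : Matrix n m ℝ) :
    2 * trace (Z * (S * Sᵀ)) - trace (Z * X * Z * (S * Sᵀ)) ≤ trace (X⁻¹ * (S * Sᵀ)) := by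
  have hdet := (isUnit_iff_isUnit_det _).1 hX.isUnit
  have hXs : (X⁻¹)ᵀ = X⁻¹ := by
    simpa [IsHermitian, conjTranspose_eq_transpose_of_trivial] using hX.inv.isHermitian
  have h := (hX.posSemidef.conjTranspose_mul_mul_same ((X⁻¹ - Z) * S)).trace_nonneg
  rw [conjTranspose_eq_transpose_of_trivial, transpose_mul, transpose_sub, hXs, hZ] at h
  have hsq : (X⁻¹ - Z) * X * (X⁻¹ - Z) = X⁻¹ - Z - Z + Z * X * Z := by
    rw [Matrix.sub_mul, nonsing_inv_mul _ hdet, Matrix.mul_sub, Matrix.sub_mul, Matrix.sub_mul,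
      Matrix.mul_assoc Z X X⁻¹, mul_nonsing_inv _ hdet]
    noncomm_ring
  have htr : trace (Sᵀ * (X⁻¹ - Z) * X * ((X⁻¹ - Z) * S))
      = trace ((X⁻¹ - Z) * X * (X⁻¹ - Z) * (S * Sᵀ)) := by
    rw [← Matrix.mul_assoc _ S Sᵀ, trace_mul_comm _ Sᵀ]
    simp only [Matrix.mul_assoc]
  rw [htr, hsq] at h
  simp only [Matrix.add_mul, Matrix.sub_mul, trace_add, trace_sub] at h ⊢
  linarith

/-- Traces against a matrix with orthonormal eigenvectors and eigenvalues at most `β`. -/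
theorem trace_mul_mul_diagonal_mul_transpose_le [DecidableEq n] {U : Matrix n k ℝ} (hU : Uᵀ * U = 1)
    {g : k → ℝ} {β : ℝ} (hβ : 0 ≤ β) (hg : ∀ i, g i ≤ β) (B : Matrix m n ℝ) :
    trace (Bᵀ * B * (U * diagonal g * Uᵀ)) ≤ β * trace (Bᵀ * B) := by
  have hperp : (1 - U * Uᵀ) * (1 - U * Uᵀ)ᵀ = 1 - U * Uᵀ := by
    have h : U * Uᵀ * (U * Uᵀ) = U * Uᵀ := by
      rw [Matrix.mul_assoc, ← Matrix.mul_assoc Uᵀ, hU, Matrix.one_mul]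
    simp only [transpose_sub, transpose_one, transpose_mul, transpose_transpose, Matrix.sub_mul,
      Matrix.mul_sub, h]
    simp
  have h1 := (posSemidef_self_mul_conjTranspose (B * (1 - U * Uᵀ))).trace_nonneg
  have h2 := ((PosSemidef.diagonal (n := k) (d := fun i => β - g i)
    (fun i => sub_nonneg.2 (hg i))).mul_mul_conjTranspose_same (B * U)).trace_nonneg
  have e1 : (B * (1 - U * Uᵀ)) * (B * (1 - U * Uᵀ))ᴴ = B * (1 - U * Uᵀ) * Bᵀ := by
    rw [conjTranspose_eq_transpose_of_trivial, transpose_mul, Matrix.mul_assoc,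
      ← Matrix.mul_assoc _ _ Bᵀ, hperp, Matrix.mul_assoc]
  have e2 : diagonal (fun i => β - g i) = β • (1 : Matrix k k ℝ) - diagonal g := by
    rw [smul_one_eq_diagonal, diagonal_sub]
  rw [e1] at h1
  rw [e2, conjTranspose_eq_transpose_of_trivial, transpose_mul] at h2
  have c1 : trace (Bᵀ * B) = trace (B * Bᵀ) := trace_mul_comm _ _
  have c2 : trace (Bᵀ * B * (U * diagonal g * Uᵀ)) = trace (B * U * diagonal g * (Uᵀ * Bᵀ)) := by
    rw [Matrix.mul_assoc, trace_mul_comm]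
    simp only [Matrix.mul_assoc]
  rw [c1, c2]
  simp only [Matrix.mul_sub, Matrix.sub_mul, trace_sub, Matrix.mul_smul, Matrix.smul_mul,
    trace_smul, Matrix.mul_one, smul_eq_mul, Matrix.mul_assoc] at h1 h2 ⊢
  nlinarith [mul_nonneg hβ h1]

theorem trace_mul_diagonal_mul_transpose {U : Matrix n k ℝ} (hU : Uᵀ * U = 1) (g : k → ℝ) :
    trace (U * diagonal g * Uᵀ) = ∑ i, g i := by
  rw [trace_mul_comm, ← Matrix.mul_assoc, hU, Matrix.one_mul, trace_diagonal]

theorem mul_diagonal_mul_transpose_add_one_inv_mul [DecidableEq n] {U : Matrix n k ℝ}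
    (hU : Uᵀ * U = 1) {d : k → ℝ} (hd : ∀ i, 0 ≤ d i) :
    (U * diagonal d * Uᵀ + 1)⁻¹ * U = U * diagonal (fun i => (1 + d i)⁻¹) := by
  have hpos : (U * diagonal d * Uᵀ + 1).PosDef := by
    have h := (PosSemidef.diagonal (n := k) (d := d) hd).mul_mul_conjTranspose_same U
    rw [conjTranspose_eq_transpose_of_trivial] at h
    exact PosDef.posSemidef_add h PosDef.one
  have hdet := (isUnit_iff_isUnit_det _).1 hpos.isUnit
  have h : (U * diagonal d * Uᵀ + 1) * (U * diagonal (fun i => (1 + d i)⁻¹)) = U := by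
    have h1 : (U * diagonal d * Uᵀ + 1) * (U * diagonal (fun i => (1 + d i)⁻¹))
        = U * (diagonal d * (Uᵀ * U) + 1) * diagonal (fun i => (1 + d i)⁻¹) := by
      simp only [Matrix.add_mul, Matrix.mul_add, Matrix.one_mul, Matrix.mul_one, Matrix.mul_assoc]
    rw [h1, hU, Matrix.mul_one, ← diagonal_one, diagonal_add, Matrix.mul_assoc,
      diagonal_mul_diagonal]
    have h2 : (fun i => (d i + 1) * (1 + d i)⁻¹) = fun _ => 1 := by
      funext i
      have := hd i
      field_simp
      ring
    rw [h2, diagonal_one, Matrix.mul_one]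
  calc (U * diagonal d * Uᵀ + 1)⁻¹ * U
      = (U * diagonal d * Uᵀ + 1)⁻¹ *
          ((U * diagonal d * Uᵀ + 1) * (U * diagonal (fun i => (1 + d i)⁻¹))) := by rw [h]
    _ = U * diagonal (fun i => (1 + d i)⁻¹) := nonsing_inv_mul_cancel_left _ _ hdet

/-- The minimum of `X ↦ tr (X⁻¹ S Sᵀ) + β tr (X - 1)` over `X = Bᵀ B + 1`, under the optimality
conditions on the eigenvalues `d` of the minimizer. -/
theorem trace_inv_add_le_of_optimality [DecidableEq n] {S : Matrix n m ℝ} {U : Matrix n k ℝ}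
    (hU : Uᵀ * U = 1) {lam d : k → ℝ} (hM : S * Sᵀ = U * diagonal lam * Uᵀ)
    {β : ℝ} (hβ : 0 ≤ β) (hd : ∀ i, 0 ≤ d i) (hle : ∀ i, lam i * (1 + d i)⁻¹ ^ 2 ≤ β)
    (hslack : ∀ i, d i * (lam i * (1 + d i)⁻¹ ^ 2) = d i * β) (B : Matrix k n ℝ) :
    trace ((U * diagonal d * Uᵀ + 1)⁻¹ * (S * Sᵀ)) + β * trace (U * diagonal d * Uᵀ)
      ≤ trace ((Bᵀ * B + 1)⁻¹ * (S * Sᵀ)) + β * trace (Bᵀ * B) := by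
  have hZU := mul_diagonal_mul_transpose_add_one_inv_mul hU hd
  have hZ : ((U * diagonal d * Uᵀ + 1)⁻¹)ᵀ = (U * diagonal d * Uᵀ + 1)⁻¹ := by
    rw [transpose_nonsing_inv]
    simp [Matrix.mul_assoc]
  set Z := (U * diagonal d * Uᵀ + 1)⁻¹
  have hUZ : Uᵀ * Z = diagonal (fun i => (1 + d i)⁻¹) * Uᵀ := by
    simpa [hZ] using congrArg transpose hZU
  have hX : (Bᵀ * B + 1).PosDef := by
    simpa using posDef_mul_transpose_self_add_one Bᵀ
  have hZM : Z * (S * Sᵀ) = U * diagonal (fun i => (1 + d i)⁻¹ * lam i) * Uᵀ := by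
    rw [hM, ← Matrix.mul_assoc, ← Matrix.mul_assoc, hZU, Matrix.mul_assoc U, diagonal_mul_diagonal]
  have hZMZ : Z * (S * Sᵀ) * Z = U * diagonal (fun i => lam i * (1 + d i)⁻¹ ^ 2) * Uᵀ := by
    rw [hZM, Matrix.mul_assoc, hUZ, ← Matrix.mul_assoc, Matrix.mul_assoc U, diagonal_mul_diagonal]
    congr 3
    funext i
    ring
  have htan := hX.two_mul_trace_sub_le_trace_inv hZ S
  have hcyc : trace (Z * (Bᵀ * B + 1) * Z * (S * Sᵀ))
      = trace (Bᵀ * B * (Z * (S * Sᵀ) * Z)) + trace (Z * (S * Sᵀ) * Z) := by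
    rw [Matrix.mul_assoc (Z * _), Matrix.mul_assoc Z (Bᵀ * B + 1), trace_mul_comm Z,
      Matrix.mul_assoc, Matrix.add_mul, Matrix.one_mul, trace_add]
  have hbound := trace_mul_mul_diagonal_mul_transpose_le hU hβ hle B
  rw [hcyc, hZMZ, hZM, trace_mul_diagonal_mul_transpose hU,
    trace_mul_diagonal_mul_transpose hU] at htan
  rw [hZM, trace_mul_diagonal_mul_transpose hU, trace_mul_diagonal_mul_transpose hU]
  have hsum : ∑ i, (1 + d i)⁻¹ * lam i
      = ∑ i, lam i * (1 + d i)⁻¹ ^ 2 + β * ∑ i, d i := by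
    rw [Finset.mul_sum, ← Finset.sum_add_distrib]
    refine Finset.sum_congr rfl fun i _ => ?_
    rw [mul_comm β, ← hslack i]
    have := hd i
    field_simp
  linarith

theorem sq_mul_trace_objective [DecidableEq n] (σ β : ℝ) (S : Matrix n m ℝ) (A : Matrix k n ℝ) :
    σ ^ 2 * (-trace (Sᵀ * Aᵀ * (σ ^ 2 • (A * Aᵀ) + 1)⁻¹ * A * S) + β * trace (Aᵀ * A))
      = trace (((σ • A)ᵀ * (σ • A) + 1)⁻¹ * (S * Sᵀ)) + β * trace ((σ • A)ᵀ * (σ • A))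
        - trace (S * Sᵀ) := by
  have h := congrArg (fun T => trace (T * (S * Sᵀ))) (transpose_mul_inv_mul_eq_one_sub_inv (σ • A))
  have hN : σ • A * (σ • A)ᵀ = σ ^ 2 • (A * Aᵀ) := by
    simp [smul_smul, sq]
  have hcyc : trace (Sᵀ * Aᵀ * (σ ^ 2 • (A * Aᵀ) + 1)⁻¹ * A * S)
      = trace (Aᵀ * (σ ^ 2 • (A * Aᵀ) + 1)⁻¹ * A * (S * Sᵀ)) := by
    rw [← Matrix.mul_assoc _ S Sᵀ, trace_mul_comm _ Sᵀ]
    simp only [Matrix.mul_assoc]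
  have hT : trace ((σ • A)ᵀ * (σ • A)) = σ ^ 2 * trace (Aᵀ * A) := by
    simp [smul_smul, sq, mul_assoc]
  have hL : trace ((σ • A)ᵀ * (σ ^ 2 • (A * Aᵀ) + 1)⁻¹ * (σ • A) * (S * Sᵀ))
      = σ ^ 2 * trace (Aᵀ * (σ ^ 2 • (A * Aᵀ) + 1)⁻¹ * A * (S * Sᵀ)) := by
    simp [smul_smul, sq, mul_assoc]
  simp only [hN, hL, Matrix.sub_mul, Matrix.one_mul, trace_sub] at h
  rw [hcyc, hT]
  linear_combination -h

end General

end Matrix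

/-- Optimal robust features for identity input covariance (MMSE
formulation).  Let `Σ_xy Σ_yx` have exactly `k` nonzero eigenvalues
`0 < λ₁ ≤ ⋯ ≤ λ_k` with orthonormal eigenvectors forming the columns of `U`, let
`d_i = √(λ_i/β) - 1` if `λ_i ≥ β` and `d_i = 0` otherwise, and set
`A* = (1/σ) D^{1/2} Uᵀ`.  Then `A*` minimizes
`G(A) = -tr(Σ_yx Aᵀ (σ² A Aᵀ + I)⁻¹ A Σ_xy) + β tr(Aᵀ A)` over all `k×p` matrices `A`
(this is, up to an additive constant, the robust information bottleneck objective
`mmse(Y|T) + β Φ(T|X)` for jointly Gaussian `(X,Y)` with `Cov(X) = σ²I` over Gaussian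
features `T = AX + ε`, `ε ~ N(0,I)`). -/
theorem mmse_fisher_gaussian_identity_optimum
    (p m k : ℕ) (σ β : ℝ) (hσ : 0 < σ) (hβ : 0 < β)
    (Sxy : Matrix (Fin p) (Fin m) ℝ)
    (lam : Fin k → ℝ) (hlampos : ∀ i, 0 < lam i) (hlammono : Monotone lam)
    (U : Matrix (Fin p) (Fin k) ℝ) (hU : Uᵀ * U = 1)
    (heig : Sxy * Sxyᵀ * U = U * Matrix.diagonal lam)
    (hrank : (Sxy * Sxyᵀ).rank = k)
    (d : Fin k → ℝ)
    (hd : ∀ i, d i = if β ≤ lam i then Real.sqrt (lam i / β) - 1 else 0)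
    (Astar : Matrix (Fin k) (Fin p) ℝ)
    (hAstar : Astar = (1 / σ) • (Matrix.diagonal (fun i => Real.sqrt (d i)) * Uᵀ)) :
    ∀ A : Matrix (Fin k) (Fin p) ℝ,
      -Matrix.trace (Sxyᵀ * Astarᵀ * (σ ^ 2 • (Astar * Astarᵀ) + 1)⁻¹ * Astar * Sxy)
          + β * Matrix.trace (Astarᵀ * Astar)
        ≤ -Matrix.trace (Sxyᵀ * Aᵀ * (σ ^ 2 • (A * Aᵀ) + 1)⁻¹ * A * Sxy)
          + β * Matrix.trace (Aᵀ * A) := by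
  intro A
  have hd_nonneg : ∀ i, 0 ≤ d i := fun i => by
    rw [hd]
    split_ifs with h
    · exact sub_nonneg.2 (Real.one_le_sqrt.2 ((one_le_div hβ).2 h))
    · exact le_rfl
  have hactive : ∀ i, β ≤ lam i → lam i * (1 + d i)⁻¹ ^ 2 = β := fun i h => by
    have hl := hlampos i
    rw [hd, if_pos h, add_sub_cancel, inv_pow, Real.sq_sqrt (by positivity)]
    field_simp
  have hinactive : ∀ i, ¬ β ≤ lam i → d i = 0 := fun i h => by rw [hd, if_neg h]
  have hle : ∀ i, lam i * (1 + d i)⁻¹ ^ 2 ≤ β := fun i => by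
    by_cases h : β ≤ lam i
    · exact (hactive i h).le
    · simpa [hinactive i h] using (not_le.1 h).le
  have hslack : ∀ i, d i * (lam i * (1 + d i)⁻¹ ^ 2) = d i * β := fun i => by
    by_cases h : β ≤ lam i
    · rw [hactive i h]
    · simp [hinactive i h]
  have hM : Sxy * Sxyᵀ = U * diagonal lam * Uᵀ :=
    eq_mul_diagonal_mul_transpose_of_rank_eq (by simp) (fun i => (hlampos i).ne') hU heig
      (by simpa using hrank)
  have hB : σ • Astar = diagonal (fun i => Real.sqrt (d i)) * Uᵀ := by
    rw [hAstar, smul_smul, mul_one_div_cancel hσ.ne', one_smul]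
  have hBB : (σ • Astar)ᵀ * (σ • Astar) = U * diagonal d * Uᵀ := by
    rw [hB, transpose_mul, transpose_transpose, diagonal_transpose, Matrix.mul_assoc,
      ← Matrix.mul_assoc (diagonal _), diagonal_mul_diagonal, ← Matrix.mul_assoc]
    simp only [Real.mul_self_sqrt (hd_nonneg _)]
  have hopt := trace_inv_add_le_of_optimality hU hM hβ.le hd_nonneg hle hslack (σ • A)
  refine le_of_mul_le_mul_left ?_ (pow_pos hσ 2)
  rw [sq_mul_trace_objective, sq_mul_trace_objective, hBB]
  linarith
end

section
/- Let (X, T) have a smooth, strictly positive joint density p_{XT} on ℝᵖ × ℝᵏ such that the marginal density p_X of X is continuously differentiable with finite differential entropy H(X) = -∫ p_X(x) log p_X(x) dx and finite Fisher information J(X) = ∫ ‖∇ log p_X(x)‖² p_X(x) dx, the conditional densities p_{T|X}(·|x) are differentiable in x, and the statistical Fisher information Φ(T|X) = ∫∫ ‖∇ₓ log p_{T|X}(t|x)‖² p_{T|X}(t|x) p_X(x) dt dx is finite. Then the mutual information I(X;T) = ∫∫ p_{XT}(x,t) log( p_{XT}(x,t) / (p_X(x) p_T(t)) ) dx dt satisfies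 I(X;T) ≤ H(X) - (p/2) log( 2πe·p / (Φ(T|X) + J(X)) ). In particular, if Φ(T|X) is bounded above, then so is I(X;T). -/
open MeasureTheory Real

section

open Filter Topology

/-! ### One-dimensional transport -/

lemma hasDerivAt_integral_Iic {m : ℝ → ℝ} (hc : Continuous m) (hi : Integrable m) (x : ℝ) :
    HasDerivAt (fun u => ∫ z in Set.Iic u, m z) (m x) x := by
  have h := (hc.integral_hasStrictDerivAt x x).hasDerivAt
  have e : (fun u => ∫ z in Set.Iic u, m z)
      = fun u => (∫ z in Set.Iic x, m z) + ∫ z in x..u, m z := by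
    funext u
    rw [← intervalIntegral.integral_Iic_sub_Iic hi.integrableOn hi.integrableOn]
    ring
  rw [e]
  exact h.const_add _

lemma strictMono_integral_Iic {m : ℝ → ℝ} (hc : Continuous m) (hpos : ∀ x, 0 < m x)
    (hi : Integrable m) : StrictMono (fun u => ∫ z in Set.Iic u, m z) :=
  strictMono_of_hasDerivAt_pos (fun x => hasDerivAt_integral_Iic hc hi x) hpos

lemma tendsto_integral_Iic_atTop {m : ℝ → ℝ} (hi : Integrable m) :
    Tendsto (fun u => ∫ z in Set.Iic u, m z) atTop (𝓝 (∫ z, m z)) := by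
  have h := tendsto_setIntegral_of_monotone (μ := volume) (f := m) (s := fun u : ℝ => Set.Iic u)
    (fun _ => measurableSet_Iic) (fun a b hab => Set.Iic_subset_Iic.2 hab)
    hi.integrableOn
  simpa [Set.iUnion_Iic] using h

lemma integral_Iic_mem_Ioo {m : ℝ → ℝ} (hc : Continuous m) (hpos : ∀ x, 0 < m x)
    (hi : Integrable m) (x : ℝ) : ∫ z in Set.Iic x, m z ∈ Set.Ioo 0 (∫ z, m z) := by
  have hs := strictMono_integral_Iic hc hpos hi
  constructor
  · exact lt_of_le_of_lt (integral_nonneg fun z => (hpos z).le) (hs (sub_one_lt x))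
  · exact lt_of_lt_of_le (hs (lt_add_one x))
      (setIntegral_le_integral hi (Eventually.of_forall fun z => (hpos z).le))

/-- The monotone rearrangement between two positive continuous densities on the line. -/
lemma exists_monotone_transport {m g : ℝ → ℝ} (hmc : Continuous m) (hm : ∀ x, 0 < m x)
    (hmi : Integrable m) (hgc : Continuous g) (hg : ∀ x, 0 < g x) (hgi : Integrable g)
    (hmg : ∫ z, m z = ∫ z, g z) :
    ∃ T : ℝ → ℝ, ∀ x, HasDerivAt T (m x / g (T x)) x := by
  set F : ℝ → ℝ := fun u => ∫ z in Set.Iic u, m z with hF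
  set G : ℝ → ℝ := fun u => ∫ z in Set.Iic u, g z with hG
  have hFd : ∀ x, HasDerivAt F (m x) x := hasDerivAt_integral_Iic hmc hmi
  have hGd : ∀ x, HasDerivAt G (g x) x := hasDerivAt_integral_Iic hgc hgi
  have hFs : StrictMono F := strictMono_integral_Iic hmc hm hmi
  have hGs : StrictMono G := strictMono_integral_Iic hgc hg hgi
  have hFc : Continuous F := continuous_iff_continuousAt.2 fun x => (hFd x).continuousAt
  have hGc : Continuous G := continuous_iff_continuousAt.2 fun x => (hGd x).continuousAt
  have hex : ∀ x, ∃ y, G y = F x := by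
    intro x
    obtain ⟨h0, h1⟩ := integral_Iic_mem_Ioo hmc hm hmi x
    rw [hmg] at h1
    have hbot : Tendsto G atBot (𝓝 0) := tendsto_integral_Iic_zero (f := g) tendsto_id
    have htop := tendsto_integral_Iic_atTop hgi
    obtain ⟨a, ha⟩ := (hbot.eventually (gt_mem_nhds h0)).exists
    obtain ⟨b, hb⟩ := (htop.eventually (lt_mem_nhds h1)).exists
    exact mem_range_of_exists_le_of_exists_ge hGc ⟨a, ha.le⟩ ⟨b, hb.le⟩
  choose T hT using hex
  have hTs : StrictMono T := fun a b hab => by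
    rw [← hGs.lt_iff_lt, hT, hT]; exact hFs hab
  have hTc : Continuous T := by
    have he : Topology.IsEmbedding G :=
      hGs.isEmbedding_of_ordConnected (isPreconnected_range hGc).ordConnected
    rw [he.continuous_iff]
    have : G ∘ T = F := funext hT
    rwa [this]
  refine ⟨T, fun x => ?_⟩
  rw [hasDerivAt_iff_tendsto_slope]
  have h1 := hasDerivAt_iff_tendsto_slope.1 (hFd x)
  have h2 := hasDerivAt_iff_tendsto_slope.1 (hGd (T x))
  have h3 : Tendsto T (𝓝[≠] x) (𝓝[≠] (T x)) :=
    (hTc.tendsto x).inf (tendsto_principal_principal.2 fun z hz h => hz (hTs.injective h))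
  have h4 := h1.div (h2.comp h3) (hg _).ne'
  refine h4.congr' ?_
  filter_upwards [self_mem_nhdsWithin] with z hz
  have hz' : z - x ≠ 0 := sub_ne_zero.2 hz
  have hT' : T z - T x ≠ 0 := sub_ne_zero.2 (hTs.injective.ne hz)
  have hF' : F z - F x ≠ 0 := sub_ne_zero.2 (hFs.injective.ne hz)
  simp only [Pi.div_apply, Function.comp, slope_def_field, hT]
  field_simp

/-- An integrable function whose derivative is bounded above by `R` forces `0 ≤ ∫ R`. -/
lemma integral_nonneg_of_hasDerivAt_le {w w' R : ℝ → ℝ} (hw : Integrable w) (hR : Integrable R)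
    (hd : ∀ x, HasDerivAt w (w' x) x) (hle : ∀ x, w' x ≤ R x) : 0 ≤ ∫ x, R x := by
  have hfreq : ∀ ε : ℝ, 0 < ε → ∀ N : ℝ, (∃ b ≥ N, |w b| < ε) ∧ (∃ a ≤ N, |w a| < ε) := by
    intro ε hε N
    have hfin := hw.measure_norm_ge_lt_top hε
    constructor
    · by_contra! h
      have : Set.Ici N ⊆ {x | ε ≤ ‖w x‖} := fun x hx => h x hx
      have := measure_mono (μ := volume) this
      rw [Real.volume_Ici] at this
      exact absurd hfin (not_lt.2 this)
    · by_contra! h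
      have : Set.Iic N ⊆ {x | ε ≤ ‖w x‖} := fun x hx => h x hx
      have := measure_mono (μ := volume) this
      rw [Real.volume_Iic] at this
      exact absurd hfin (not_lt.2 this)
  have hseq : ∀ n : ℕ, ∃ a b : ℝ, a ≤ -n ∧ (n : ℝ) ≤ b ∧ |w a| < 1 / (n + 1) ∧
      |w b| < 1 / (n + 1) := by
    intro n
    have hn : (0 : ℝ) < 1 / (n + 1) := by positivity
    obtain ⟨b, hb, hb'⟩ := (hfreq _ hn n).1
    obtain ⟨a, ha, ha'⟩ := (hfreq _ hn (-n)).2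
    exact ⟨a, b, ha, hb, ha', hb'⟩
  choose a b ha hb hwa hwb using hseq
  have hat : Tendsto a atTop atBot :=
    tendsto_atBot_mono ha (tendsto_neg_atTop_atBot.comp tendsto_natCast_atTop_atTop)
  have hbt : Tendsto b atTop atTop := tendsto_atTop_mono hb tendsto_natCast_atTop_atTop
  have hlim := intervalIntegral_tendsto_integral hR hat hbt
  have hlow : Tendsto (fun n : ℕ => -(2 * (1 / ((n : ℝ) + 1)))) atTop (𝓝 (-(2 * 0))) :=
    (tendsto_one_div_add_atTop_nhds_zero_nat.const_mul 2).neg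
  rw [mul_zero, neg_zero] at hlow
  refine le_of_tendsto_of_tendsto' hlow hlim fun n => ?_
  have hab : a n ≤ b n := by
    have := ha n; have := hb n
    have : (0 : ℝ) ≤ n := n.cast_nonneg
    linarith
  have hc : Continuous w := continuous_iff_continuousAt.2 fun x => (hd x).continuousAt
  have := intervalIntegral.sub_le_integral_of_hasDeriv_right_of_le hab hc.continuousOn
    (fun x _ => (hd x).hasDerivWithinAt) hR.integrableOn (fun x _ => hle x)
  have h1 := abs_lt.1 (hwa n)
  have h2 := abs_lt.1 (hwb n)
  linarith [h1.2, h2.1]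

/-- A density is bounded by the `L¹` norm of its derivative. -/
lemma le_integral_abs_deriv {m D : ℝ → ℝ} (hm : Integrable m) (hd : ∀ x, HasDerivAt m (D x) x)
    (hD : Integrable D) (x : ℝ) : m x ≤ ∫ z, |D z| := by
  by_contra! h
  have hlt : 0 < m x - ∫ z, |D z| := sub_pos.2 h
  have hfin := hm.measure_norm_ge_lt_top hlt
  have hall : ∀ a, m x - ∫ z, |D z| ≤ ‖m a‖ := by
    intro a
    have hftc := intervalIntegral.integral_eq_sub_of_hasDerivAt (a := a) (b := x)
      (fun z _ => hd z) hD.intervalIntegrable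
    have h1 : |∫ z in a..x, D z| ≤ ∫ z, |D z| := by
      rw [← Real.norm_eq_abs]
      refine (intervalIntegral.norm_integral_le_integral_norm_uIoc (f := D)).trans ?_
      exact setIntegral_le_integral hD.norm (Eventually.of_forall fun z => norm_nonneg _)
    have h2 := le_abs_self (∫ z in a..x, D z)
    have h3 := le_abs_self (m a)
    rw [Real.norm_eq_abs]
    linarith
  have huniv : {a | m x - ∫ z, |D z| ≤ ‖m a‖} = Set.univ := Set.eq_univ_of_forall hall
  rw [huniv, Real.volume_univ] at hfin
  exact lt_irrefl _ hfin

lemma abs_le_half_sq_div_add {d u : ℝ} (hu : 0 < u) : |d| ≤ (d ^ 2 / u + u) / 2 := by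
  have h : d ^ 2 / u + u - 2 * |d| = (|d| - u) ^ 2 / u := by
    rw [← sq_abs d]; field_simp; ring
  have h2 : 0 ≤ (|d| - u) ^ 2 / u := by positivity
  linarith

lemma integrable_of_sq_div {α : Type*} [MeasurableSpace α] {μ : Measure α} {d u : α → ℝ}
    (hd : AEStronglyMeasurable d μ) (hu : ∀ x, 0 < u x) (hui : Integrable u μ)
    (hJ : Integrable (fun x => d x ^ 2 / u x) μ) : Integrable d μ :=
  ((hJ.add hui).div_const 2).mono' hd
    (Eventually.of_forall fun x => abs_le_half_sq_div_add (hu x))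

/-- Euclidean logarithmic Sobolev inequality on the line, in linearised form. -/
lemma integral_mul_log_le {m D : ℝ → ℝ} (hm : ∀ x, 0 < m x) (hd : ∀ x, HasDerivAt m (D x) x)
    (hmi : Integrable m) (hm1 : ∫ z, m z = 1) (hJ : Integrable fun x => D x ^ 2 / m x)
    (hL : Integrable fun x => m x * Real.log (m x)) {s : ℝ} (hs : 0 < s) :
    ∫ x, m x * Real.log (m x)
      ≤ s / 2 * (∫ x, D x ^ 2 / m x) + (-1 - Real.log (2 * π * s) / 2) := by
  have hmc : Continuous m := continuous_iff_continuousAt.2 fun x => (hd x).continuousAt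
  set v : NNReal := ⟨s, hs.le⟩ with hv
  have hv0 : v ≠ 0 := fun h => hs.ne' (congrArg NNReal.toReal h)
  set g : ℝ → ℝ := ProbabilityTheory.gaussianPDFReal 0 v with hg
  have hgp : ∀ x, 0 < g x := fun x => ProbabilityTheory.gaussianPDFReal_pos 0 v x hv0
  have hgf : ∀ x, g x = (√(2 * π * s))⁻¹ * rexp (-x ^ 2 / (2 * s)) := by
    intro x
    simp only [hg, ProbabilityTheory.gaussianPDFReal, sub_zero]
    rfl
  have hgc : Continuous g := by
    rw [funext hgf]; fun_prop
  have hgi : Integrable g := ProbabilityTheory.integrable_gaussianPDFReal 0 v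
  have hg1 : ∫ x, g x = 1 := ProbabilityTheory.integral_gaussianPDFReal_eq_one 0 hv0
  have hlogg : ∀ x, Real.log (g x) = -(Real.log (2 * π * s) / 2) - x ^ 2 / (2 * s) := by
    intro x
    have h0 : 0 < 2 * π * s := by positivity
    rw [hgf, Real.log_mul (by positivity) (by positivity), Real.log_inv, Real.log_exp,
      Real.log_sqrt h0.le]
    ring
  have hg2 : Integrable fun x => x ^ 2 * g x := by
    have := (integrable_rpow_mul_exp_neg_mul_sq (b := 1 / (2 * s)) (by positivity) (s := 2)
      (by norm_num)).const_mul ((√(2 * π * s))⁻¹)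
    refine this.congr (Eventually.of_forall fun x => ?_)
    simp only [hgf, Real.rpow_two]
    rw [show -(1 / (2 * s)) * x ^ 2 = -x ^ 2 / (2 * s) by ring]
    ring
  obtain ⟨T, hT⟩ := exists_monotone_transport hmc hm hmi hgc hgp hgi (hm1.trans hg1.symm)
  have hTc : Continuous T := continuous_iff_continuousAt.2 fun x => (hT x).continuousAt
  have hT' : ∀ x, 0 < m x / g (T x) := fun x => div_pos (hm x) (hgp _)
  have hTs : StrictMono T := strictMono_of_hasDerivAt_pos hT hT'
  have hmT2 : Integrable fun x => m x * T x ^ 2 := by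
    have h := (integrableOn_image_iff_integrableOn_abs_deriv_smul MeasurableSet.univ
      (fun x _ => (hT x).hasDerivWithinAt) (hTs.injective.injOn) (fun x => x ^ 2 * g x)).1
      hg2.integrableOn
    rw [integrableOn_univ] at h
    refine h.congr (Eventually.of_forall fun x => ?_)
    simp only [smul_eq_mul]
    rw [abs_of_pos (hT' x)]
    field_simp [(hgp (T x)).ne']
  have hmT : Integrable fun x => m x * T x := by
    refine ((hmi.add hmT2).div_const 2).mono' (hmc.mul hTc).aestronglyMeasurable
      (Eventually.of_forall fun x => ?_)
    rw [Real.norm_eq_abs, abs_mul, abs_of_pos (hm x)]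
    have h0 : 0 ≤ m x * (|T x| - 1) ^ 2 := mul_nonneg (hm x).le (sq_nonneg _)
    have h2 : m x * (|T x| - 1) ^ 2 = m x * T x ^ 2 - 2 * (m x * |T x|) + m x := by
      rw [← sq_abs (T x)]; ring
    simp only [Pi.add_apply]
    linarith
  set C : ℝ := -1 - Real.log (2 * π * s) / 2 with hC
  have hRi : Integrable fun x => C * m x + s / 2 * (D x ^ 2 / m x) - m x * Real.log (m x) :=
    ((hmi.const_mul C).add (hJ.const_mul _)).sub hL
  have key := integral_nonneg_of_hasDerivAt_le hmT.neg hRi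
    (fun x => ((hd x).mul (hT x)).neg) (fun x => by
      have hx := hm x
      have hlog : Real.log (m x) = Real.log (g (T x)) + Real.log (m x / g (T x)) := by
        rw [Real.log_div hx.ne' (hgp _).ne']; ring
      have h1 := Real.log_le_sub_one_of_pos (hT' x)
      have h2 : Real.log (m x) ≤ C - T x ^ 2 / (2 * s) + m x / g (T x) := by
        rw [hlog, hlogg]; linarith
      have h3 := mul_le_mul_of_nonneg_left h2 hx.le
      have h4 : -(D x * T x) ≤ m x * (T x ^ 2 / (2 * s)) + s / 2 * (D x ^ 2 / m x) := by
        have : m x * (T x ^ 2 / (2 * s)) + s / 2 * (D x ^ 2 / m x) + D x * T x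
            = (m x * T x + s * D x) ^ 2 / (2 * s * m x) := by field_simp; ring
        have h5 : 0 ≤ (m x * T x + s * D x) ^ 2 / (2 * s * m x) := by positivity
        linarith
      linarith)
  have e1 : ∫ x, C * m x + s / 2 * (D x ^ 2 / m x) - m x * Real.log (m x)
      = (∫ x, C * m x + s / 2 * (D x ^ 2 / m x)) - ∫ x, m x * Real.log (m x) :=
    integral_sub ((hmi.const_mul C).add (hJ.const_mul _)) hL
  have e2 : ∫ x, C * m x + s / 2 * (D x ^ 2 / m x)
      = (∫ x, C * m x) + ∫ x, s / 2 * (D x ^ 2 / m x) :=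
    integral_add (hmi.const_mul C) (hJ.const_mul _)
  rw [e1, e2, integral_const_mul, integral_const_mul, hm1] at key
  linarith

/-! ### One-sided entropy bounds -/

/-- The positive part of `L` is integrable against the density `f`, and the integral of `L`
against `f` is at most `b` as soon as it converges. -/
def HasEntropyBound {α : Type*} [MeasurableSpace α] (μ : Measure α) (f L : α → ℝ) (b : ℝ) : Prop :=
  Integrable (fun x => f x * max (L x) 0) μ ∧
    (Integrable (fun x => f x * L x) μ → ∫ x, f x * L x ∂μ ≤ b)

namespace HasEntropyBound

variable {α β : Type*} [MeasurableSpace α] [MeasurableSpace β] {μ : Measure α} {ν : Measure β}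
  {f L L₁ L₂ : α → ℝ} {b b₁ b₂ : ℝ}

lemma congr (h : HasEntropyBound μ f L₁ b) (hL : L₁ =ᵐ[μ] L₂) : HasEntropyBound μ f L₂ b := by
  refine ⟨h.1.congr ?_, fun hi => ?_⟩
  · filter_upwards [hL] with x hx
    rw [hx]
  · have e : (fun x => f x * L₂ x) =ᵐ[μ] fun x => f x * L₁ x := by
      filter_upwards [hL] with x hx
      rw [hx]
    rw [integral_congr_ae e]
    exact h.2 (hi.congr e)

lemma add (h₁ : HasEntropyBound μ f L₁ b₁) (h₂ : HasEntropyBound μ f L₂ b₂) (hf : Measurable f)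
    (hf0 : ∀ x, 0 ≤ f x) (hL₁ : Measurable L₁) (hL₂ : Measurable L₂) :
    HasEntropyBound μ f (fun x => L₁ x + L₂ x) (b₁ + b₂) := by
  constructor
  · refine (h₁.1.add h₂.1).mono' (by fun_prop) (Eventually.of_forall fun x => ?_)
    rw [Real.norm_eq_abs, abs_of_nonneg (mul_nonneg (hf0 x) (le_max_right _ _)), Pi.add_apply,
      ← mul_add]
    refine mul_le_mul_of_nonneg_left (max_le ?_ ?_) (hf0 x)
    · exact add_le_add (le_max_left _ _) (le_max_left _ _)
    · exact add_nonneg (le_max_right _ _) (le_max_right _ _)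
  · intro hi
    have hbound : ∀ x, |f x * L₁ x| ≤
        |f x * (L₁ x + L₂ x)| + f x * max (L₁ x) 0 + f x * max (L₂ x) 0 := by
      intro x
      have h0 := hf0 x
      have a1 := mul_le_mul_of_nonneg_left (le_max_left (L₁ x) 0) h0
      have a2 := mul_le_mul_of_nonneg_left (le_max_left (L₂ x) 0) h0
      have p1 := mul_nonneg h0 (le_max_right (L₁ x) 0)
      have p2 := mul_nonneg h0 (le_max_right (L₂ x) 0)
      have n1 := neg_abs_le (f x * (L₁ x + L₂ x))
      have n2 := abs_nonneg (f x * (L₁ x + L₂ x))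
      have e := mul_add (f x) (L₁ x) (L₂ x)
      rw [abs_le]
      constructor <;> linarith
    have hi₁ : Integrable (fun x => f x * L₁ x) μ :=
      ((hi.abs.add h₁.1).add h₂.1).mono' (by fun_prop) (Eventually.of_forall hbound)
    have hi₂ : Integrable (fun x => f x * L₂ x) μ :=
      (hi.sub hi₁).congr (Eventually.of_forall fun x => by simp only [Pi.sub_apply]; ring)
    simp only [mul_add]
    rw [integral_add hi₁ hi₂]
    exact add_le_add (h₁.2 hi₁) (h₂.2 hi₂)

lemma comp_iff {e : β ≃ᵐ α} (he : MeasurePreserving e ν μ) :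
    HasEntropyBound ν (fun x => f (e x)) (fun x => L (e x)) b ↔ HasEntropyBound μ f L b := by
  unfold HasEntropyBound
  rw [← he.integrable_comp_emb e.measurableEmbedding,
    ← he.integrable_comp_emb e.measurableEmbedding (g := fun x => f x * L x),
    ← he.integral_comp e.measurableEmbedding]
  rfl

end HasEntropyBound

lemma integral_pos_of_ae_pos {α : Type*} [MeasurableSpace α] {μ : Measure α} [NeZero μ]
    {f : α → ℝ} (hf : ∀ᵐ x ∂μ, 0 < f x) (hi : Integrable f μ) : 0 < ∫ x, f x ∂μ := by
  have h0 : 0 ≤ᵐ[μ] f := hf.mono fun x hx => hx.le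
  refine lt_of_le_of_ne (integral_nonneg_of_ae h0) fun h => ?_
  have h1 := (integral_eq_zero_iff_of_nonneg_ae h0 hi).1 h.symm
  obtain ⟨x, hx, hx'⟩ := (hf.and h1).exists
  exact hx.ne' hx'

lemma mul_max_log_div_le {m D : ℝ → ℝ} (hm : ∀ x, 0 < m x) (hd : ∀ x, HasDerivAt m (D x) x)
    (hmi : Integrable m) (hJ : Integrable fun x => D x ^ 2 / m x) (x : ℝ) :
    m x * max (Real.log (m x / ∫ z, m z)) 0
      ≤ m x * (((∫ z, D z ^ 2 / m z) / (∫ z, m z) + 1) / 2) := by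
  have hDm : AEStronglyMeasurable D volume := by
    rw [show D = deriv m from funext fun z => (hd z).deriv.symm]
    exact (measurable_deriv m).aestronglyMeasurable
  have hD : Integrable D := integrable_of_sq_div hDm hm hmi hJ
  have hr : 0 < ∫ z, m z := integral_pos_of_ae_pos (Eventually.of_forall hm) hmi
  have hJ0 : 0 ≤ ∫ z, D z ^ 2 / m z :=
    integral_nonneg fun z => div_nonneg (sq_nonneg _) (hm z).le
  refine mul_le_mul_of_nonneg_left (max_le ?_ (by positivity)) (hm x).le
  have h1 : m x ≤ ((∫ z, D z ^ 2 / m z) + ∫ z, m z) / 2 := by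
    refine (le_integral_abs_deriv hmi hd hD x).trans ?_
    rw [← integral_add hJ hmi, ← integral_div]
    exact integral_mono hD.abs ((hJ.add hmi).div_const 2) fun z => abs_le_half_sq_div_add (hm z)
  calc Real.log (m x / ∫ z, m z) ≤ m x / ∫ z, m z :=
        (Real.log_le_sub_one_of_pos (div_pos (hm x) hr)).trans (sub_le_self _ zero_le_one)
    _ ≤ (((∫ z, D z ^ 2 / m z) + ∫ z, m z) / 2) / ∫ z, m z := by gcongr
    _ = _ := by field_simp

lemma integral_mul_log_div_le {m D : ℝ → ℝ} (hm : ∀ x, 0 < m x) (hd : ∀ x, HasDerivAt m (D x) x)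
    (hmi : Integrable m) (hJ : Integrable fun x => D x ^ 2 / m x)
    (hL : Integrable fun x => m x * Real.log (m x / ∫ z, m z)) {s : ℝ} (hs : 0 < s) :
    ∫ x, m x * Real.log (m x / ∫ z, m z)
      ≤ s / 2 * (∫ x, D x ^ 2 / m x) + (-1 - Real.log (2 * π * s) / 2) * ∫ z, m z := by
  have hr : 0 < ∫ z, m z := integral_pos_of_ae_pos (Eventually.of_forall hm) hmi
  set r := ∫ z, m z with hr'
  have eJ : ∀ x, (D x / r) ^ 2 / (m x / r) = D x ^ 2 / m x / r := fun x => by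
    have := (hm x).ne'
    field_simp
  have eL : ∀ x, m x / r * Real.log (m x / r) = m x * Real.log (m x / r) / r := fun x => by ring
  have h := integral_mul_log_le (m := fun x => m x / r) (D := fun x => D x / r)
    (fun x => div_pos (hm x) hr) (fun x => (hd x).div_const r) (hmi.div_const r)
    (by rw [integral_div, ← hr', div_self hr.ne'])
    (by simpa only [eJ] using hJ.div_const r) (by simpa only [eL] using hL.div_const r) hs
  simp only [eJ, eL, integral_div] at h
  rw [div_le_iff₀ hr] at h
  refine h.trans (le_of_eq ?_)
  field_simp

/-- Conditional form of the one-dimensional logarithmic Sobolev inequality. -/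
lemma hasEntropyBound_log_div_integral {Y : Type*} [MeasurableSpace Y] {ν : Measure Y} [SFinite ν]
    {m D : Y × ℝ → ℝ} (hmm : Measurable m) (hm : ∀ p, 0 < m p)
    (hd : ∀ y z, HasDerivAt (fun z' => m (y, z')) (D (y, z)) z)
    (hmi : Integrable m (ν.prod volume))
    (hJ : Integrable (fun p => D p ^ 2 / m p) (ν.prod volume)) {s : ℝ} (hs : 0 < s) :
    HasEntropyBound (ν.prod volume) m (fun p => Real.log (m p / ∫ z, m (p.1, z)))
      (s / 2 * (∫ p, D p ^ 2 / m p ∂(ν.prod volume))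
        + (-1 - Real.log (2 * π * s) / 2) * ∫ p, m p ∂(ν.prod volume)) := by
  have hrm : Measurable fun y => ∫ z, m (y, z) :=
    (StronglyMeasurable.integral_prod_right
      (f := fun y z => m (y, z)) hmm.stronglyMeasurable).measurable
  have hsl : ∀ᵐ y ∂ν, Integrable (fun z => m (y, z)) ∧
      Integrable (fun z => D (y, z) ^ 2 / m (y, z)) := by
    filter_upwards [hmi.prod_right_ae, hJ.prod_right_ae] with y h1 h2 using ⟨h1, h2⟩
  constructor
  · have haem : AEStronglyMeasurable
        (fun p : Y × ℝ => m p * max (Real.log (m p / ∫ z, m (p.1, z))) 0) (ν.prod volume) := by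
      have : Measurable fun p : Y × ℝ => ∫ z, m (p.1, z) := hrm.comp measurable_fst
      fun_prop
    rw [integrable_prod_iff haem]
    have hle : ∀ᵐ y ∂ν, ∀ z, ‖m (y, z) * max (Real.log (m (y, z) / ∫ z, m (y, z))) 0‖ ≤
        m (y, z) * (((∫ z, D (y, z) ^ 2 / m (y, z)) / (∫ z, m (y, z)) + 1) / 2) := by
      filter_upwards [hsl] with y hy z
      rw [Real.norm_eq_abs, abs_of_nonneg (mul_nonneg (hm _).le (le_max_right _ _))]
      exact mul_max_log_div_le (fun z => hm (y, z)) (hd y) hy.1 hy.2 z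
    have hint : ∀ᵐ y ∂ν,
        Integrable fun z => m (y, z) * max (Real.log (m (y, z) / ∫ z, m (y, z))) 0 := by
      filter_upwards [hsl, hle] with y hy hy'
      refine (hy.1.mul_const _).mono' ?_ (Eventually.of_forall hy')
      have : Measurable fun z => m (y, z) := hmm.comp measurable_prodMk_left
      fun_prop
    refine ⟨hint, ?_⟩
    refine ((hJ.integral_prod_left.add hmi.integral_prod_left).div_const 2).mono'
      haem.norm.integral_prod_right' ?_
    filter_upwards [hsl, hle, hint] with y hy hy' hy''
    rw [Real.norm_eq_abs, abs_of_nonneg (integral_nonneg fun z => norm_nonneg _)]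
    have hr : 0 < ∫ z, m (y, z) :=
      integral_pos_of_ae_pos (Eventually.of_forall fun z => hm (y, z)) hy.1
    refine (integral_mono hy''.norm (hy.1.mul_const _) hy').trans (le_of_eq ?_)
    rw [integral_mul_const]
    simp only [Pi.add_apply]
    field_simp
  · intro hi
    rw [integral_prod _ hi, integral_prod _ hJ, integral_prod _ hmi, ← integral_const_mul,
      ← integral_const_mul, ← integral_add (hJ.integral_prod_left.const_mul _)
        (hmi.integral_prod_left.const_mul _)]
    refine integral_mono_ae hi.integral_prod_left
      ((hJ.integral_prod_left.const_mul _).add (hmi.integral_prod_left.const_mul _)) ?_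
    filter_upwards [hsl, hi.prod_right_ae] with y hy hy'
    exact integral_mul_log_div_le (fun z => hm (y, z)) (hd y) hy.1 hy.2 hy' hs

/-! ### Tensorisation -/

/-- Exchange of the last two factors of a triple product. -/
def prodRightSwap (Y Z W : Type*) [MeasurableSpace Y] [MeasurableSpace Z] [MeasurableSpace W] :
    (Y × Z) × W ≃ᵐ (Y × W) × Z :=
  (MeasurableEquiv.prodAssoc.trans
    ((MeasurableEquiv.refl Y).prodCongr MeasurableEquiv.prodComm)).trans
      MeasurableEquiv.prodAssoc.symm

lemma measurePreserving_prodRightSwap {Y Z W : Type*} [MeasurableSpace Y] [MeasurableSpace Z]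
    [MeasurableSpace W] (ν : Measure Y) (κ : Measure Z) (ω : Measure W) [SFinite ν] [SFinite κ]
    [SFinite ω] :
    MeasurePreserving (prodRightSwap Y Z W) ((ν.prod κ).prod ω) ((ν.prod ω).prod κ) := by
  have h1 := measurePreserving_prodAssoc ν κ ω
  have h2 : MeasurePreserving (Prod.map (id : Y → Y) (Prod.swap : Z × W → W × Z))
      (ν.prod (κ.prod ω)) (ν.prod (ω.prod κ)) :=
    (MeasurePreserving.id ν).prod Measure.measurePreserving_swap
  have h3 := (measurePreserving_prodAssoc ν ω κ).symm MeasurableEquiv.prodAssoc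
  exact h3.comp (h2.comp h1)

/-- Conditioning on further variables decreases entropy. -/
lemma HasEntropyBound.marginal {Y Z W : Type*} [MeasurableSpace Y] [MeasurableSpace Z]
    [MeasurableSpace W] {ν : Measure Y} {κ : Measure Z} {ω : Measure W} [SFinite ν] [SFinite κ]
    [SFinite ω] [NeZero κ] [NeZero ω] {f : (Y × Z) × W → ℝ} {b : ℝ} (hfm : Measurable f)
    (hf : ∀ p, 0 < f p) (hfi : Integrable f ((ν.prod κ).prod ω))
    (h : HasEntropyBound ((ν.prod κ).prod ω) f
      (fun p => Real.log (f p / ∫ z, f ((p.1.1, z), p.2) ∂κ)) b) :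
    HasEntropyBound ((ν.prod κ).prod ω) f
      (fun p => Real.log ((∫ w, f (p.1, w) ∂ω) / ∫ z, ∫ w, f ((p.1.1, z), w) ∂ω ∂κ)) b := by
  set μ := (ν.prod κ).prod ω
  set m : Y × Z → ℝ := fun p => ∫ w, f (p, w) ∂ω with hm
  set q : Y × W → ℝ := fun p => ∫ z, f ((p.1, z), p.2) ∂κ with hq
  set r : Y → ℝ := fun y => ∫ z, m (y, z) ∂κ with hr
  have hmm : Measurable m := (StronglyMeasurable.integral_prod_right
    (f := fun p w => f (p, w)) hfm.stronglyMeasurable).measurable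
  have hqm : Measurable q := (StronglyMeasurable.integral_prod_right
    (f := fun (p : Y × W) z => f ((p.1, z), p.2))
    (hfm.comp (prodRightSwap Y W Z).measurable).stronglyMeasurable).measurable
  have hrm : Measurable r := (StronglyMeasurable.integral_prod_right
    (f := fun y z => m (y, z)) hmm.stronglyMeasurable).measurable
  have hmi : Integrable m (ν.prod κ) := hfi.integral_prod_left
  have hmpos : ∀ᵐ p ∂(ν.prod κ), 0 < m p := by
    filter_upwards [hfi.prod_right_ae] with p hp
    exact integral_pos_of_ae_pos (Eventually.of_forall fun w => hf (p, w)) hp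
  have hrpos : ∀ᵐ y ∂ν, 0 < r y := by
    filter_upwards [Measure.ae_ae_of_ae_prod hmpos, hmi.prod_right_ae] with y h1 h2
    exact integral_pos_of_ae_pos h1 h2
  have hfi' : Integrable (fun p : (Y × W) × Z => f ((p.1.1, p.2), p.1.2))
      ((ν.prod ω).prod κ) :=
    ((measurePreserving_prodRightSwap ν ω κ).integrable_comp_emb
      (prodRightSwap Y W Z).measurableEmbedding).2 hfi
  have hqpos : ∀ᵐ p ∂(ν.prod ω), 0 < q p := by
    filter_upwards [hfi'.prod_right_ae] with p hp
    exact integral_pos_of_ae_pos (Eventually.of_forall fun z => hf _) hp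
  have hqi : Integrable q (ν.prod ω) := hfi'.integral_prod_left
  have hassoc : Integrable (fun p : Y × (Z × W) => f ((p.1, p.2.1), p.2.2))
      (ν.prod (κ.prod ω)) :=
    (((measurePreserving_prodAssoc ν κ ω).symm MeasurableEquiv.prodAssoc).integrable_comp_emb
      MeasurableEquiv.prodAssoc.symm.measurableEmbedding).2 hfi
  have hqr : ∀ᵐ y ∂ν, ∫ w, q (y, w) ∂ω = r y := by
    filter_upwards [hassoc.prod_right_ae] with y hy
    exact (integral_integral_swap (f := fun z w => f ((y, z), w)) hy).symm
  set B : (Y × Z) × W → ℝ := fun p => m p.1 / r p.1.1 * q (p.1.1, p.2) with hB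
  have hBm : Measurable B := by
    have h1 : Measurable fun p : (Y × Z) × W => m p.1 := hmm.comp measurable_fst
    have h2 : Measurable fun p : (Y × Z) × W => r p.1.1 :=
      hrm.comp (measurable_fst.comp measurable_fst)
    have h3 : Measurable fun p : (Y × Z) × W => q (p.1.1, p.2) :=
      hqm.comp ((measurable_fst.comp measurable_fst).prodMk measurable_snd)
    exact (h1.div h2).mul h3
  have hq0 : ∀ p, 0 ≤ q p := fun p => integral_nonneg fun z => (hf _).le
  have hm0 : ∀ p, 0 ≤ m p := fun p => integral_nonneg fun z => (hf _).le
  have hr0 : ∀ y, 0 ≤ r y := fun y => integral_nonneg fun z => hm0 _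
  have hB0 : ∀ p, 0 ≤ B p := fun p => mul_nonneg (div_nonneg (hm0 _) (hr0 _)) (hq0 _)
  have hfst : ∀ {P : Y → Prop}, (∀ᵐ y ∂ν, P y) → ∀ᵐ p ∂(ν.prod κ), P p.1 :=
    fun hP => Measure.quasiMeasurePreserving_fst.ae hP
  have hBint : ∀ᵐ p ∂(ν.prod κ), ∫ w, B (p, w) ∂ω = m p := by
    filter_upwards [hfst hqr, hfst hrpos] with p h1 h2
    simp only [hB]
    rw [integral_const_mul, h1, div_mul_cancel₀ _ h2.ne']
  have hBi : Integrable B μ := by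
    rw [integrable_prod_iff hBm.aestronglyMeasurable]
    constructor
    · filter_upwards [hfst hqi.prod_right_ae] with p hp
      exact hp.const_mul (m p / r p.1)
    · refine hmi.congr ?_
      filter_upwards [hBint] with p hp
      simp only [Real.norm_of_nonneg (hB0 _)]
      exact hp.symm
  have hBf : ∫ p, B p ∂μ = ∫ p, f p ∂μ := by
    rw [integral_prod _ hBi, integral_prod _ hfi]
    exact integral_congr_ae hBint
  have hKm : Measurable fun p => Real.log (f p / q (p.1.1, p.2)) :=
    (hfm.div (hqm.comp ((measurable_fst.comp measurable_fst).prodMk measurable_snd))).log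
  have hLm : Measurable fun p : (Y × Z) × W => Real.log (m p.1 / r p.1.1) :=
    ((hmm.comp measurable_fst).div (hrm.comp (measurable_fst.comp measurable_fst))).log
  have hle : ∀ᵐ p ∂μ, f p * Real.log (m p.1 / r p.1.1)
      ≤ f p * Real.log (f p / q (p.1.1, p.2)) + B p - f p := by
    have a1 : ∀ᵐ p ∂μ, 0 < m p.1 := Measure.quasiMeasurePreserving_fst.ae hmpos
    have a2 : ∀ᵐ p ∂μ, 0 < r p.1.1 := Measure.quasiMeasurePreserving_fst.ae (hfst hrpos)
    have a3 : ∀ᵐ p ∂μ, 0 < q (p.1.1, p.2) :=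
      (measurePreserving_prodRightSwap ν κ ω).quasiMeasurePreserving.ae
        (Measure.quasiMeasurePreserving_fst.ae hqpos)
    filter_upwards [a1, a2, a3] with p h1 h2 h3
    have h4 := hf p
    have hlog : Real.log (m p.1 / r p.1.1) - Real.log (f p / q (p.1.1, p.2))
        = Real.log (B p / f p) := by
      rw [← Real.log_div (by positivity) (by positivity)]
      congr 1
      simp only [hB]
      field_simp
    have h5 := Real.log_le_sub_one_of_pos
      (div_pos (mul_pos (div_pos h1 h2) h3 : 0 < B p) h4)
    have h6 := mul_le_mul_of_nonneg_left (hlog.le.trans h5) h4.le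
    have h7 : f p * (B p / f p - 1) = B p - f p := by field_simp
    rw [h7] at h6
    linarith
  constructor
  · refine (h.1.add hBi).mono' (by fun_prop) ?_
    filter_upwards [hle] with p hp
    have hfp := (hf p).le
    rw [Real.norm_eq_abs, abs_of_nonneg (mul_nonneg hfp (le_max_right _ _)), Pi.add_apply,
      mul_max_of_nonneg _ _ hfp, mul_zero]
    have a1 := mul_le_mul_of_nonneg_left (le_max_left (Real.log (f p / q (p.1.1, p.2))) 0) hfp
    have a2 := mul_nonneg hfp (le_max_right (Real.log (f p / q (p.1.1, p.2))) 0)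
    have a3 := hB0 p
    refine max_le ?_ (add_nonneg a2 a3)
    linarith
  · intro hi
    have hKi : Integrable (fun p => f p * Real.log (f p / q (p.1.1, p.2))) μ := by
      refine (((hi.abs.add hBi).add hfi).add h.1).mono' (by fun_prop) ?_
      filter_upwards [hle] with p hp
      have hfp := (hf p).le
      have a1 := mul_le_mul_of_nonneg_left (le_max_left (Real.log (f p / q (p.1.1, p.2))) 0) hfp
      have a2 := mul_nonneg hfp (le_max_right (Real.log (f p / q (p.1.1, p.2))) 0)
      have a3 := hB0 p
      have a4 := neg_abs_le (f p * Real.log (m p.1 / r p.1.1))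
      have a5 := abs_nonneg (f p * Real.log (m p.1 / r p.1.1))
      simp only [Pi.add_apply]
      rw [Real.norm_eq_abs, abs_le]
      constructor <;> linarith
    have e : ∫ p, f p * Real.log (f p / q (p.1.1, p.2)) + B p - f p ∂μ
        = ∫ p, f p * Real.log (f p / q (p.1.1, p.2)) ∂μ := by
      have e1 : ∫ p, f p * Real.log (f p / q (p.1.1, p.2)) + B p - f p ∂μ
          = (∫ p, f p * Real.log (f p / q (p.1.1, p.2)) + B p ∂μ) - ∫ p, f p ∂μ :=
        integral_sub (hKi.add hBi) hfi
      have e2 : ∫ p, f p * Real.log (f p / q (p.1.1, p.2)) + B p ∂μ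
          = (∫ p, f p * Real.log (f p / q (p.1.1, p.2)) ∂μ) + ∫ p, B p ∂μ :=
        integral_add hKi hBi
      rw [e1, e2, hBf]
      ring
    have := integral_mono_ae hi ((hKi.add hBi).sub hfi) hle
    exact (this.trans e.le).trans (h.2 hKi)

/-- Conditional logarithmic Sobolev inequality in dimension `n`, in linearised form. -/
theorem hasEntropyBound_log_div_integral_pi (n : ℕ) {s : ℝ} (hs : 0 < s) :
    ∀ {Y : Type} [MeasurableSpace Y] {ν : Measure Y} [SFinite ν] {f : Y × (Fin n → ℝ) → ℝ}
      {D : Fin n → Y × (Fin n → ℝ) → ℝ}, Measurable f → (∀ p, 0 < f p) →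
      (∀ i y x, HasDerivAt (fun z => f (y, Function.update x i z)) (D i (y, x)) (x i)) →
      Integrable f (ν.prod volume) →
      (∀ i, Integrable (fun p => D i p ^ 2 / f p) (ν.prod volume)) →
      HasEntropyBound (ν.prod volume) f (fun p => Real.log (f p / ∫ x, f (p.1, x)))
        (s / 2 * (∑ i, ∫ p, D i p ^ 2 / f p ∂(ν.prod volume))
          + n * ((-1 - Real.log (2 * π * s) / 2) * ∫ p, f p ∂(ν.prod volume))) := by
  induction n with
  | zero =>
    intro Y _ ν _ f D hfm hf hd hfi hJ
    have hL : (fun p : Y × (Fin 0 → ℝ) => Real.log (f p / ∫ x, f (p.1, x))) = fun _ => 0 := by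
      funext p
      have : ∫ x, f (p.1, x) = f p := by
        rw [volume_pi, Measure.pi_of_empty (x := p.2), integral_dirac]
      rw [this, div_self (hf p).ne', Real.log_one]
    rw [hL]
    exact ⟨by simp, fun _ => by simp⟩
  | succ n ih =>
    intro Y _ ν _ f D hfm hf hd hfi hJ
    set C := -1 - Real.log (2 * π * s) / 2 with hC
    set e₀ : (Fin (n + 1) → ℝ) ≃ᵐ ℝ × (Fin n → ℝ) :=
      MeasurableEquiv.piFinSuccAbove (fun _ => ℝ) 0 with he₀
    have he₀p : MeasurePreserving e₀.symm volume volume :=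
      (volume_preserving_piFinSuccAbove (fun _ : Fin (n + 1) => ℝ) 0).symm e₀
    have he₀s : ∀ z w, e₀.symm (z, w) = Fin.cons z w := fun z w => by
      rw [he₀]
      exact Fin.insertNth_zero' z w
    set e : (Y × ℝ) × (Fin n → ℝ) ≃ᵐ Y × (Fin (n + 1) → ℝ) :=
      MeasurableEquiv.prodAssoc.trans ((MeasurableEquiv.refl Y).prodCongr e₀.symm) with he
    have hep : MeasurePreserving e ((ν.prod volume).prod volume) (ν.prod volume) :=
      ((MeasurePreserving.id ν).prod he₀p).comp (measurePreserving_prodAssoc ν volume volume)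
    have hes : ∀ y z w, e ((y, z), w) = (y, Fin.cons z w) := fun y z w =>
      congrArg (Prod.mk y) (he₀s z w)
    set f' : (Y × ℝ) × (Fin n → ℝ) → ℝ := fun p => f (e p) with hf'
    have hf'm : Measurable f' := hfm.comp e.measurable
    have hf'p : ∀ p, 0 < f' p := fun p => hf _
    have hcomp : ∀ {g : Y × (Fin (n + 1) → ℝ) → ℝ}, Integrable g (ν.prod volume) →
        Integrable (fun p => g (e p)) ((ν.prod volume).prod volume) := fun hg =>
      (hep.integrable_comp_emb e.measurableEmbedding).2 hg
    have hintc : ∀ g : Y × (Fin (n + 1) → ℝ) → ℝ,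
        ∫ p, g (e p) ∂((ν.prod volume).prod volume) = ∫ p, g p ∂(ν.prod volume) := fun g =>
      hep.integral_comp e.measurableEmbedding g
    have hf'i := hcomp hfi
    have htail := ih (ν := ν.prod (volume : Measure ℝ)) (f := f')
      (D := fun i p => D i.succ (e p)) hf'm hf'p
      (fun i p x => by
        obtain ⟨y, z⟩ := p
        have := hd i.succ y (Fin.cons z x)
        simp only [hf', hes, Fin.cons_update]
        simpa using this) hf'i (fun i => hcomp (hJ i.succ))
    have hσp := measurePreserving_prodRightSwap ν (volume : Measure ℝ)
      (volume : Measure (Fin n → ℝ))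
    set τ := prodRightSwap Y (Fin n → ℝ) ℝ
    have hτp := measurePreserving_prodRightSwap ν (volume : Measure (Fin n → ℝ))
      (volume : Measure ℝ)
    have hhead := hasEntropyBound_log_div_integral (ν := ν.prod (volume : Measure (Fin n → ℝ)))
      (m := fun p => f' (τ p)) (D := fun p => D 0 (e (τ p))) (hf'm.comp τ.measurable)
      (fun p => hf _)
      (fun p z => by
        obtain ⟨y, w⟩ := p
        have := hd 0 y (Fin.cons z w)
        simp only [Fin.update_cons_zero, Fin.cons_zero] at this
        convert this using 1
        · funext z'
          exact congrArg f (hes y z' w)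
        · exact congrArg (D 0) (hes y z w))
      ((hτp.integrable_comp_emb τ.measurableEmbedding).2 hf'i)
      ((hτp.integrable_comp_emb τ.measurableEmbedding).2 (hcomp (hJ 0))) hs
    have hhead' := ((HasEntropyBound.comp_iff hσp).2 hhead)
    have hmarg := HasEntropyBound.marginal hf'm hf'p hf'i hhead'
    have hmm : Measurable fun p : Y × ℝ => ∫ w, f' (p, w) :=
      (StronglyMeasurable.integral_prod_right
        (f := fun p w => f' (p, w)) hf'm.stronglyMeasurable).measurable
    have hrm : Measurable fun y : Y => ∫ z, ∫ w, f' ((y, z), w) :=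
      (StronglyMeasurable.integral_prod_right
        (f := fun y z => ∫ w, f' ((y, z), w)) hmm.stronglyMeasurable).measurable
    have hsum := htail.add hmarg hf'm (fun p => (hf'p p).le)
      (hf'm.div (hmm.comp measurable_fst)).log
      ((hmm.comp measurable_fst).div (hrm.comp (measurable_fst.comp measurable_fst))).log
    rw [← HasEntropyBound.comp_iff hep]
    have hmi := hf'i.integral_prod_left
    have hmpos : ∀ᵐ p ∂(ν.prod (volume : Measure ℝ)), 0 < ∫ w, f' (p, w) := by
      filter_upwards [hf'i.prod_right_ae] with p hp
      exact integral_pos_of_ae_pos (Eventually.of_forall fun w => hf'p (p, w)) hp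
    have hrpos : ∀ᵐ y ∂ν, 0 < ∫ z, ∫ w, f' ((y, z), w) := by
      filter_upwards [Measure.ae_ae_of_ae_prod hmpos, hmi.prod_right_ae] with y h1 h2
      exact integral_pos_of_ae_pos h1 h2
    have hreq : ∀ᵐ y ∂ν, ∫ x, f (y, x) = ∫ z, ∫ w, f' ((y, z), w) := by
      filter_upwards [hfi.prod_right_ae] with y hy
      rw [← he₀p.integral_comp e₀.symm.measurableEmbedding]
      exact integral_prod _ ((he₀p.integrable_comp_emb e₀.symm.measurableEmbedding).2 hy)
    have hfinal := hsum.congr (L₂ := fun p => Real.log (f (e p) / ∫ x, f ((e p).1, x))) (by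
      filter_upwards [Measure.quasiMeasurePreserving_fst.ae hmpos,
        Measure.quasiMeasurePreserving_fst.ae (Measure.quasiMeasurePreserving_fst.ae hrpos),
        Measure.quasiMeasurePreserving_fst.ae (Measure.quasiMeasurePreserving_fst.ae hreq)]
        with p h1 h2 h3
      have h4 := hf'p p
      have h5 : (e p).1 = p.1.1 := rfl
      rw [h5, h3, ← Real.log_mul (by positivity) (by positivity)]
      congr 1
      simp only [hf'] at h1 ⊢
      field_simp)
    have e1 : ∫ p, D 0 (e (τ p)) ^ 2 / f' (τ p) ∂((ν.prod volume).prod volume)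
        = ∫ p, D 0 p ^ 2 / f p ∂(ν.prod volume) :=
      (hτp.integral_comp τ.measurableEmbedding fun p => D 0 (e p) ^ 2 / f (e p)).trans
        (hintc fun p => D 0 p ^ 2 / f p)
    have e2 : ∫ p, f' (τ p) ∂((ν.prod volume).prod volume) = ∫ p, f p ∂(ν.prod volume) :=
      (hτp.integral_comp τ.measurableEmbedding f').trans (hintc f)
    have e3 : ∫ p, f' p ∂((ν.prod volume).prod volume) = ∫ p, f p ∂(ν.prod volume) := hintc f
    have e4 : ∀ i : Fin n, ∫ p, D i.succ (e p) ^ 2 / f' p ∂((ν.prod volume).prod volume)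
        = ∫ p, D i.succ p ^ 2 / f p ∂(ν.prod volume) := fun i =>
      hintc fun p => D i.succ p ^ 2 / f p
    simp only [e1, e2, e3, e4] at hfinal
    refine cast ?_ hfinal
    congr 1
    rw [Fin.sum_univ_succ]
    push_cast
    ring

/-! ### Marginals and Fisher information -/

/-- If the marginal of a positive continuous joint density is continuous and not identically zero,
then it vanishes nowhere. -/
lemma marginal_ne_zero {E F : Type*} [TopologicalSpace E] [FirstCountableTopology E]
    [PreconnectedSpace E] [TopologicalSpace F] [MeasurableSpace F] [BorelSpace F]
    {κ : Measure F} [NeZero κ] {f : E → F → ℝ} (hf : Continuous (Function.uncurry f))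
    (hpos : ∀ x t, 0 < f x t) (hc : Continuous fun x => ∫ t, f x t ∂κ)
    (hne : ∃ x, ∫ t, f x t ∂κ ≠ 0) (x : E) : ∫ t, f x t ∂κ ≠ 0 := by
  set p : E → ℝ := fun x => ∫ t, f x t ∂κ with hp
  have hclosed : IsClosed {x | p x = 0} := isClosed_eq hc continuous_const
  have hopen : IsOpen {x | p x = 0} := by
    rw [isOpen_iff_mem_nhds]
    intro x₀ hx₀
    by_contra hnot
    set u : Filter E := 𝓝 x₀ ⊓ 𝓟 {x | p x = 0}ᶜ with hu
    have : u.NeBot := by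
      refine mem_closure_iff_clusterPt.1 ?_
      rw [closure_compl, Set.mem_compl_iff, mem_interior_iff_mem_nhds]
      exact hnot
    have hmeas : ∀ x, Measurable fun t => ENNReal.ofReal (f x t) := fun x =>
      (ENNReal.continuous_ofReal.comp
        (hf.comp (continuous_const.prodMk continuous_id) : Continuous fun t => f x t)).measurable
    have hfatou := lintegral_liminf_le (μ := κ) (u := u) hmeas
    have h1 : ∀ t, liminf (fun x => ENNReal.ofReal (f x t)) u = ENNReal.ofReal (f x₀ t) := by
      intro t
      refine Tendsto.liminf_eq (Tendsto.mono_left ?_ inf_le_left)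
      have : Continuous fun x => f x t := hf.comp (continuous_id.prodMk continuous_const)
      exact (ENNReal.continuous_ofReal.comp this).tendsto x₀
    have h2 : liminf (fun x => ∫⁻ t, ENNReal.ofReal (f x t) ∂κ) u = 0 := by
      have h3 : Tendsto (fun x => ENNReal.ofReal (p x)) u (𝓝 (ENNReal.ofReal (p x₀))) :=
        ((ENNReal.continuous_ofReal.comp hc).tendsto x₀).mono_left inf_le_left
      rw [show p x₀ = 0 from hx₀, ENNReal.ofReal_zero] at h3
      refine Tendsto.liminf_eq (h3.congr' ?_)
      filter_upwards [show {x | p x = 0}ᶜ ∈ u from mem_inf_of_right (mem_principal_self _)]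
        with x hx
      have hi : Integrable (fun t => f x t) κ := by
        by_contra h
        exact hx (integral_undef h)
      exact ofReal_integral_eq_lintegral_ofReal hi (Eventually.of_forall fun t => (hpos x t).le)
    simp only [h1] at hfatou
    rw [h2, nonpos_iff_eq_zero, lintegral_eq_zero_iff (hmeas x₀)] at hfatou
    obtain ⟨t, ht⟩ := hfatou.exists
    exact (ENNReal.ofReal_pos.2 (hpos x₀ t)).ne' ht
  rcases isClopen_iff.1 ⟨hclosed, hopen⟩ with h | h
  · intro hx
    exact (h ▸ (show x ∈ {x | p x = 0} from hx) : x ∈ (∅ : Set E))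
  · obtain ⟨y, hy⟩ := hne
    exact absurd (h ▸ Set.mem_univ y : y ∈ {x | p x = 0}) hy

/-- Differentiation of a marginal under the integral sign, almost everywhere. -/
lemma ae_integral_fderiv_eq {E F : Type*} [NormedAddCommGroup E] [NormedSpace ℝ E]
    [FiniteDimensional ℝ E] [MeasurableSpace E] [BorelSpace E] {μ : Measure E}
    [μ.IsAddHaarMeasure] [MeasurableSpace F] {κ : Measure F} [SFinite κ] {h d : E × F → ℝ}
    {p : E → ℝ} {v : E} (hh : Integrable h (μ.prod κ)) (hd : Integrable d (μ.prod κ))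
    (hdiff : ∀ t x, DifferentiableAt ℝ (fun x' => h (x', t)) x)
    (hder : ∀ t x, fderiv ℝ (fun x' => h (x', t)) x v = d (x, t))
    (hp : ContDiff ℝ 1 p) (hpint : ∀ x, p x = ∫ t, h (x, t) ∂κ) :
    ∀ᵐ x ∂μ, ∫ t, d (x, t) ∂κ = fderiv ℝ p x v := by
  have hdc : Continuous fun x => fderiv ℝ p x v :=
    (hp.continuous_fderiv one_ne_zero).clm_apply continuous_const
  refine ae_eq_of_integral_contDiff_smul_eq hd.integral_prod_left.locallyIntegrable
    hdc.locallyIntegrable fun φ hφ hφc => ?_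
  have hφd : Differentiable ℝ φ := hφ.differentiable (by simp)
  have hφ' : Continuous fun x => fderiv ℝ φ x v :=
    (hφ.continuous_fderiv (by simp)).clm_apply continuous_const
  have hφ'c : HasCompactSupport fun x => fderiv ℝ φ x v := hφc.fderiv_apply ℝ v
  obtain ⟨C, hC⟩ := hφ.continuous.bounded_above_of_compact_support hφc
  obtain ⟨C', hC'⟩ := hφ'.bounded_above_of_compact_support hφ'c
  have hbd : ∀ {g : E × F → ℝ}, Integrable g (μ.prod κ) →
      Integrable (fun z => φ z.1 * g z) (μ.prod κ) := fun hg =>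
    hg.bdd_mul (hφ.continuous.measurable.comp measurable_fst).aestronglyMeasurable
      (Eventually.of_forall fun z => hC z.1)
  have hbd' : Integrable (fun z => fderiv ℝ φ z.1 v * h z) (μ.prod κ) :=
    hh.bdd_mul (hφ'.measurable.comp measurable_fst).aestronglyMeasurable
      (Eventually.of_forall fun z => hC' z.1)
  have hslice : ∀ᵐ t ∂κ, ∫ x, φ x * d (x, t) ∂μ = -∫ x, fderiv ℝ φ x v * h (x, t) ∂μ := by
    filter_upwards [(hbd hd).prod_left_ae, (hbd hh).prod_left_ae, hbd'.prod_left_ae]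
      with t h1 h2 h3
    have := integral_mul_fderiv_eq_neg_fderiv_mul_of_integrable (μ := μ) (f := φ)
      (g := fun x => h (x, t)) (v := v) h3 (by simpa only [hder] using h1) h2
      (fun x _ => hφd x) (fun x _ => hdiff t x)
    simpa only [hder] using this
  have hparts := integral_mul_fderiv_eq_neg_fderiv_mul_of_integrable (μ := μ) (f := φ) (g := p)
    (v := v) ((hφ'.mul hp.continuous).integrable_of_hasCompactSupport hφ'c.mul_right)
    ((hφ.continuous.mul hdc).integrable_of_hasCompactSupport hφc.mul_right)
    ((hφ.continuous.mul hp.continuous).integrable_of_hasCompactSupport hφc.mul_right)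
    (fun x _ => hφd x) (fun x _ => hp.differentiable one_ne_zero x)
  simp only [smul_eq_mul]
  calc ∫ x, φ x * ∫ t, d (x, t) ∂κ ∂μ = ∫ x, ∫ t, φ x * d (x, t) ∂κ ∂μ := by
        simp only [integral_const_mul]
    _ = ∫ t, ∫ x, φ x * d (x, t) ∂μ ∂κ := integral_integral_swap (hbd hd)
    _ = ∫ t, -∫ x, fderiv ℝ φ x v * h (x, t) ∂μ ∂κ := integral_congr_ae hslice
    _ = -∫ t, ∫ x, fderiv ℝ φ x v * h (x, t) ∂μ ∂κ := integral_neg _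
    _ = -∫ x, ∫ t, fderiv ℝ φ x v * h (x, t) ∂κ ∂μ := by
        rw [integral_integral_swap (f := fun x t => fderiv ℝ φ x v * h (x, t)) hbd']
    _ = -∫ x, fderiv ℝ φ x v * p x ∂μ := by simp only [integral_const_mul, hpint]
    _ = _ := hparts.symm

/-- A function of the first variable times a joint density integrates like the function against
the marginal density. -/
lemma integrable_fst_mul_and_integral_eq {E F : Type*} [MeasurableSpace E] [MeasurableSpace F]
    {μ : Measure E} {κ : Measure F} [SFinite μ] [SFinite κ] {h : E × F → ℝ} {c p : E → ℝ}
    (hc : Measurable c) (hh0 : ∀ z, 0 ≤ h z) (hh : Integrable h (μ.prod κ))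
    (hp : ∀ x, p x = ∫ t, h (x, t) ∂κ) (hi : Integrable (fun x => c x * p x) μ) :
    Integrable (fun z => c z.1 * h z) (μ.prod κ) ∧
      ∫ z, c z.1 * h z ∂(μ.prod κ) = ∫ x, c x * p x ∂μ := by
  have hint : Integrable (fun z => c z.1 * h z) (μ.prod κ) := by
    have haem : AEStronglyMeasurable (fun z : E × F => c z.1 * h z) (μ.prod κ) :=
      (hc.comp measurable_fst).aestronglyMeasurable.mul hh.aestronglyMeasurable
    rw [integrable_prod_iff haem]
    constructor
    · filter_upwards [hh.prod_right_ae] with x hx using hx.const_mul _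
    · refine hi.norm.congr (Eventually.of_forall fun x => ?_)
      have : ∀ t, ‖c x * h (x, t)‖ = |c x| * h (x, t) := fun t => by
        rw [norm_mul, Real.norm_eq_abs, Real.norm_of_nonneg (hh0 _)]
      simp only [this, integral_const_mul, ← hp, norm_mul, Real.norm_eq_abs]
      rw [abs_of_nonneg (a := p x) (by rw [hp]; exact integral_nonneg fun t => hh0 _)]
  refine ⟨hint, ?_⟩
  rw [integral_prod _ hint]
  simp only [integral_const_mul, ← hp]

/-- Chain rule for one coordinate of the Fisher information. -/
lemma integral_sq_div_chain {E F : Type*} [NormedAddCommGroup E] [NormedSpace ℝ E]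
    [FiniteDimensional ℝ E] [MeasurableSpace E] [BorelSpace E] {μ : Measure E}
    [μ.IsAddHaarMeasure] [MeasurableSpace F] {κ : Measure F} [SFinite κ] {h d : E × F → ℝ}
    {p : E → ℝ} {v : E} (hh : Integrable h (μ.prod κ)) (hpos : ∀ z, 0 < h z) (hdm : Measurable d)
    (hhm : Measurable h)
    (hdiff : ∀ t x, DifferentiableAt ℝ (fun x' => h (x', t)) x)
    (hder : ∀ t x, fderiv ℝ (fun x' => h (x', t)) x v = d (x, t))
    (hp : ContDiff ℝ 1 p) (hpint : ∀ x, p x = ∫ t, h (x, t) ∂κ) (hppos : ∀ x, 0 < p x)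
    (hJ : Integrable (fun x => (fderiv ℝ p x v / p x) ^ 2 * p x) μ)
    (hΦ : Integrable (fun z => (d z / h z - fderiv ℝ p z.1 v / p z.1) ^ 2 * h z) (μ.prod κ)) :
    Integrable (fun z => d z ^ 2 / h z) (μ.prod κ) ∧
      ∫ z, d z ^ 2 / h z ∂(μ.prod κ)
        = (∫ z, (d z / h z - fderiv ℝ p z.1 v / p z.1) ^ 2 * h z ∂(μ.prod κ))
          + ∫ x, (fderiv ℝ p x v / p x) ^ 2 * p x ∂μ := by
  set c : E → ℝ := fun x => fderiv ℝ p x v / p x with hc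
  have hcm : Measurable c :=
    (((hp.continuous_fderiv one_ne_zero).clm_apply continuous_const).div hp.continuous
      fun x => (hppos x).ne').measurable
  have hcm' : Measurable fun z : E × F => c z.1 := hcm.comp measurable_fst
  obtain ⟨hc2, hc2'⟩ := integrable_fst_mul_and_integral_eq (c := fun x => c x ^ 2)
    (hcm.pow_const 2) (fun z => (hpos z).le) hh hpint hJ
  have hsq : Integrable (fun z => d z ^ 2 / h z) (μ.prod κ) := by
    refine ((hΦ.const_mul 2).add (hc2.const_mul 2)).mono'
      ((hdm.pow_const 2).div hhm).aestronglyMeasurable (Eventually.of_forall fun z => ?_)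
    have hz := hpos z
    rw [Real.norm_of_nonneg (by positivity), Pi.add_apply]
    have e : 2 * ((d z / h z - c z.1) ^ 2 * h z) + 2 * (c z.1 ^ 2 * h z) - d z ^ 2 / h z
        = (d z / h z - 2 * c z.1) ^ 2 * h z := by field_simp; ring
    have : 0 ≤ (d z / h z - 2 * c z.1) ^ 2 * h z := by positivity
    linarith
  have hdi : Integrable d (μ.prod κ) :=
    integrable_of_sq_div hdm.aestronglyMeasurable hpos hh hsq
  have hcd : Integrable (fun z => c z.1 * d z) (μ.prod κ) := by
    refine ((hsq.add hc2).div_const 2).mono' (by fun_prop) (Eventually.of_forall fun z => ?_)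
    have hz := hpos z
    rw [Real.norm_eq_abs, abs_mul, Pi.add_apply]
    have e : d z ^ 2 / h z + c z.1 ^ 2 * h z - 2 * (|c z.1| * |d z|)
        = (|d z| - |c z.1| * h z) ^ 2 / h z := by
      rw [← sq_abs (d z), ← sq_abs (c z.1)]; field_simp; ring
    have : 0 ≤ (|d z| - |c z.1| * h z) ^ 2 / h z := by positivity
    linarith
  refine ⟨hsq, ?_⟩
  have hcd' : ∫ z, c z.1 * d z ∂(μ.prod κ) = ∫ x, c x ^ 2 * p x ∂μ := by
    rw [integral_prod _ hcd]
    refine integral_congr_ae ?_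
    filter_upwards [ae_integral_fderiv_eq hh hdi hdiff hder hp hpint] with x hx
    have := (hppos x).ne'
    simp only [integral_const_mul, hx, hc]
    field_simp
  have e : ∀ z, d z ^ 2 / h z
      = ((d z / h z - c z.1) ^ 2 * h z + 2 * (c z.1 * d z)) - c z.1 ^ 2 * h z := fun z => by
    have := (hpos z).ne'
    field_simp
    ring
  have e1 := integral_sub (hΦ.add (hcd.const_mul 2)) hc2
  have e2 := integral_add hΦ (hcd.const_mul 2)
  simp only [Pi.add_apply] at e1
  simp only [e]
  rw [e1, e2, integral_const_mul, hcd', hc2']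
  ring

lemma norm_gradient_sq {n : ℕ} (g : EuclideanSpace ℝ (Fin n) → ℝ)
    (x : EuclideanSpace ℝ (Fin n)) :
    ‖gradient g x‖ ^ 2 = ∑ i, (fderiv ℝ g x (EuclideanSpace.single i 1)) ^ 2 := by
  rw [EuclideanSpace.norm_sq_eq]
  refine Finset.sum_congr rfl fun i _ => ?_
  rw [Real.norm_eq_abs, sq_abs]
  congr 1
  have hi : ∀ v : EuclideanSpace ℝ (Fin n), inner ℝ v (EuclideanSpace.single i 1) = v i := by
    intro v
    simp [EuclideanSpace.inner_single_right]
  rw [← hi, gradient, InnerProductSpace.toDual_symm_apply]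

/-- Fisher information of a joint density in the first variable: the statistical Fisher information
of the conditionals plus the Fisher information of the marginal. -/
lemma sum_integral_sq_fderiv_div {n : ℕ} {F : Type*} [NormedAddCommGroup F] [NormedSpace ℝ F]
    [MeasurableSpace F] [BorelSpace F] [SecondCountableTopology F] {κ : Measure F} [SFinite κ]
    {h : EuclideanSpace ℝ (Fin n) × F → ℝ} {p : EuclideanSpace ℝ (Fin n) → ℝ}
    (hsm : ContDiff ℝ 1 h) (hpos : ∀ z, 0 < h z) (hh : Integrable h (volume.prod κ))
    (hp : ContDiff ℝ 1 p) (hpint : ∀ x, p x = ∫ t, h (x, t) ∂κ) (hppos : ∀ x, 0 < p x)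
    (hJ : Integrable (fun x => ‖gradient (fun x' => Real.log (p x')) x‖ ^ 2 * p x))
    (hΦ : Integrable (fun z : EuclideanSpace ℝ (Fin n) × F =>
      ‖gradient (fun x' => Real.log (h (x', z.2) / p x')) z.1‖ ^ 2 * h z) (volume.prod κ)) :
    (∀ i, Integrable (fun z => fderiv ℝ h z (EuclideanSpace.single i 1, 0) ^ 2 / h z)
      (volume.prod κ)) ∧
    ∑ i, ∫ z, fderiv ℝ h z (EuclideanSpace.single i 1, 0) ^ 2 / h z ∂(volume.prod κ)
      = (∫ z : EuclideanSpace ℝ (Fin n) × F,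
          ‖gradient (fun x' => Real.log (h (x', z.2) / p x')) z.1‖ ^ 2 * h z ∂(volume.prod κ))
        + ∫ x, ‖gradient (fun x' => Real.log (p x')) x‖ ^ 2 * p x := by
  have hpd : Differentiable ℝ p := hp.differentiable one_ne_zero
  have hslice : ∀ x t, HasFDerivAt (fun x' => h (x', t))
      ((fderiv ℝ h (x, t)).comp (ContinuousLinearMap.inl ℝ (EuclideanSpace ℝ (Fin n)) F)) x :=
    fun x t => ((hsm.differentiable one_ne_zero (x, t)).hasFDerivAt).comp x
      (hasFDerivAt_prodMk_left x t)
  have hlogp : ∀ x v, fderiv ℝ (fun x' => Real.log (p x')) x v = fderiv ℝ p x v / p x := by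
    intro x v
    rw [((hpd x).hasFDerivAt.log (hppos x).ne').fderiv]
    simp [div_eq_inv_mul]
  have hlogq : ∀ x t v, fderiv ℝ (fun x' => Real.log (h (x', t) / p x')) x v
      = fderiv ℝ h (x, t) (v, 0) / h (x, t) - fderiv ℝ p x v / p x := by
    intro x t v
    have e : (fun x' => Real.log (h (x', t) / p x'))
        = fun x' => Real.log (h (x', t)) - Real.log (p x') := by
      funext x'
      exact Real.log_div (hpos _).ne' (hppos _).ne'
    rw [e, (((hslice x t).log (hpos _).ne').fun_sub
      ((hpd x).hasFDerivAt.log (hppos x).ne')).fderiv]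
    simp [div_eq_inv_mul]
  have hdc : ∀ i : Fin n, Continuous fun z : EuclideanSpace ℝ (Fin n) × F =>
      fderiv ℝ h z (EuclideanSpace.single i 1, 0) := fun i =>
    (hsm.continuous_fderiv one_ne_zero).clm_apply continuous_const
  have hac : ∀ i : Fin n, Continuous fun x => fderiv ℝ p x (EuclideanSpace.single i 1) := fun i =>
    (hp.continuous_fderiv one_ne_zero).clm_apply continuous_const
  simp only [norm_gradient_sq, hlogp, hlogq, Finset.sum_mul] at hJ hΦ ⊢
  have hJi : ∀ i : Fin n, Integrable (fun x =>
      (fderiv ℝ p x (EuclideanSpace.single i 1) / p x) ^ 2 * p x) := fun i => by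
    refine hJ.mono' ((((hac i).div hp.continuous fun x => (hppos x).ne').pow 2).mul
      hp.continuous).aestronglyMeasurable (Eventually.of_forall fun x => ?_)
    have := hppos x
    rw [Real.norm_of_nonneg (by positivity)]
    exact Finset.single_le_sum
      (f := fun i => (fderiv ℝ p x (EuclideanSpace.single i 1) / p x) ^ 2 * p x)
      (fun j _ => by positivity) (Finset.mem_univ i)
  have hΦi : ∀ i : Fin n, Integrable (fun z : EuclideanSpace ℝ (Fin n) × F =>
      (fderiv ℝ h z (EuclideanSpace.single i 1, 0) / h z
        - fderiv ℝ p z.1 (EuclideanSpace.single i 1) / p z.1) ^ 2 * h z) (volume.prod κ) :=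
      fun i => by
    refine hΦ.mono' ((((((hdc i).div hsm.continuous fun z => (hpos z).ne').sub
      (((hac i).div hp.continuous fun x => (hppos x).ne').comp continuous_fst)).pow 2).mul
      hsm.continuous).measurable.aestronglyMeasurable) (Eventually.of_forall fun z => ?_)
    have := hpos z
    rw [Real.norm_of_nonneg (by positivity)]
    exact Finset.single_le_sum
      (f := fun i => (fderiv ℝ h z (EuclideanSpace.single i 1, 0) / h z
        - fderiv ℝ p z.1 (EuclideanSpace.single i 1) / p z.1) ^ 2 * h z)
      (fun j _ => by positivity) (Finset.mem_univ i)
  have hchain := fun i : Fin n => integral_sq_div_chain (μ := volume) (κ := κ) hh hpos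
    (hdc i).measurable hsm.continuous.measurable
    (fun t x => (hslice x t).differentiableAt)
    (fun t x => by rw [(hslice x t).fderiv]; simp) hp hpint hppos (hJi i) (hΦi i)
  refine ⟨fun i => (hchain i).1, ?_⟩
  rw [integral_finsetSum _ fun i _ => hJi i, integral_finsetSum _ fun i _ => hΦi i,
    ← Finset.sum_add_distrib]
  exact Finset.sum_congr rfl fun i _ => (hchain i).2

/-- Entropic Cramér–Rao bound for the conditional entropy of the first variable, linearised at a
Gaussian of variance `s`. -/
lemma hasEntropyBound_log_div_integral_euclidean {n : ℕ} {F : Type} [NormedAddCommGroup F]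
    [NormedSpace ℝ F] [MeasurableSpace F] [BorelSpace F] [SecondCountableTopology F]
    {κ : Measure F} [SFinite κ] {s : ℝ} (hs : 0 < s) {h : EuclideanSpace ℝ (Fin n) × F → ℝ}
    (hsm : ContDiff ℝ 1 h) (hpos : ∀ z, 0 < h z) (hh : Integrable h (volume.prod κ))
    (hd : ∀ i, Integrable (fun z => fderiv ℝ h z (EuclideanSpace.single i 1, 0) ^ 2 / h z)
      (volume.prod κ)) :
    HasEntropyBound (volume.prod κ) h (fun z => Real.log (h z / ∫ x, h (x, z.2)))
      (s / 2 * (∑ i, ∫ z, fderiv ℝ h z (EuclideanSpace.single i 1, 0) ^ 2 / h z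
          ∂(volume.prod κ))
        + n * ((-1 - Real.log (2 * π * s) / 2) * ∫ z, h z ∂(volume.prod κ))) := by
  let e : F × (Fin n → ℝ) ≃ᵐ EuclideanSpace ℝ (Fin n) × F :=
    ((MeasurableEquiv.refl F).prodCongr (MeasurableEquiv.toLp 2 (Fin n → ℝ))).trans
      MeasurableEquiv.prodComm
  have he : MeasurePreserving e (κ.prod volume) (volume.prod κ) :=
    Measure.measurePreserving_swap.comp
      ((MeasurePreserving.id κ).prod (PiLp.volume_preserving_toLp (Fin n)))
  have he_apply : ∀ t x, e (t, x) = (WithLp.toLp 2 x, t) := fun _ _ => rfl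
  have hint : ∀ g : EuclideanSpace ℝ (Fin n) × F → ℝ,
      ∫ z, g (e z) ∂(κ.prod volume) = ∫ z, g z ∂(volume.prod κ) := fun g =>
    he.integral_comp e.measurableEmbedding g
  have hder : ∀ (i : Fin n) (t : F) (x : Fin n → ℝ),
      HasDerivAt (fun z => h (e (t, Function.update x i z)))
        (fderiv ℝ h (e (t, x)) (EuclideanSpace.single i 1, 0)) (x i) := by
    intro i t x
    have hline : HasDerivAt (fun z => e (t, Function.update x i z))
        ((EuclideanSpace.single i 1, 0) : EuclideanSpace ℝ (Fin n) × F) (x i) := by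
      have hup : (fun z => e (t, Function.update x i z)) = fun z =>
          (WithLp.toLp 2 x + (z - x i) • (EuclideanSpace.single i 1 : EuclideanSpace ℝ (Fin n)),
            t) := by
        funext z
        refine Prod.ext ?_ rfl
        ext j
        by_cases hj : j = i
        · subst hj
          simp [he_apply]
        · simp [he_apply, hj]
      rw [hup]
      refine HasDerivAt.prodMk ?_ (hasDerivAt_const _ _)
      simpa using (((hasDerivAt_id (x i)).sub_const (x i)).smul_const
        (EuclideanSpace.single i 1 : EuclideanSpace ℝ (Fin n))).const_add (WithLp.toLp 2 x)
    have h1 : HasFDerivAt h (fderiv ℝ h (e (t, x))) (e (t, Function.update x i (x i))) := by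
      rw [Function.update_eq_self]
      exact (hsm.differentiable one_ne_zero _).hasFDerivAt
    exact h1.comp_hasDerivAt (x i) hline
  have key := hasEntropyBound_log_div_integral_pi n hs (ν := κ) (f := fun z => h (e z))
    (D := fun i z => fderiv ℝ h (e z) (EuclideanSpace.single i 1, 0))
    (hsm.continuous.measurable.comp e.measurable) (fun z => hpos _) hder
    ((he.integrable_comp_emb e.measurableEmbedding).2 hh)
    (fun i => (he.integrable_comp_emb e.measurableEmbedding).2 (hd i))
  simp only [fun i => hint fun z => fderiv ℝ h z (EuclideanSpace.single i 1, 0) ^ 2 / h z,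
    hint h] at key
  refine (HasEntropyBound.comp_iff he).1 ?_
  convert key using 2 with z
  have : ∫ x, h (e (z.1, x)) = ∫ x, h (x, z.1) :=
    (PiLp.volume_preserving_toLp (Fin n)).integral_comp
      (MeasurableEquiv.toLp 2 (Fin n → ℝ)).measurableEmbedding fun x => h (x, z.1)
  change Real.log (h (e z) / _) = Real.log (h (e z) / _)
  rw [this]
  rfl

/-- Optimisation over the variance of the reference Gaussian. -/
lemma le_neg_mul_log_of_forall_variance {n I a : ℝ} (hn : 0 ≤ n) (hI : 0 ≤ I) (hnI : n = 0 → I = 0)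
    (h : ∀ s, 0 < s → a ≤ s / 2 * I + n * (-1 - Real.log (2 * π * s) / 2)) :
    a ≤ -(n / 2 * Real.log (2 * π * Real.exp 1 * n / I)) := by
  rcases hI.eq_or_lt with rfl | hI
  · have := h (1 / (2 * π)) (by positivity)
    rw [mul_one_div_cancel (by positivity)] at this
    simp only [Real.log_one, div_zero, Real.log_zero] at this ⊢
    linarith
  · have hn : 0 < n := hn.lt_of_ne' fun h0 => hI.ne' (hnI h0)
    have := h (n / I) (by positivity)
    have e : 2 * π * Real.exp 1 * n / I = Real.exp 1 * (2 * π * (n / I)) := by ring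
    rw [e, Real.log_mul (by positivity) (by positivity), Real.log_exp]
    have e' : n / I / 2 * I = n / 2 := by field_simp
    linarith

end

/-- Robustness implies compression: for a smooth strictly positive
joint density `p_{XT}` on `ℝᵖ × ℝᵏ` whose `X`-marginal `p_X` has finite entropy
`H(X) = -∫ p_X log p_X` and finite Fisher information `J(X) = ∫ ‖∇ log p_X‖² p_X`, and
whose conditionals `p_{T|X}(t|x) = p_{XT}(x,t)/p_X(x)` are differentiable in `x` with
finite statistical Fisher information `Φ(T|X)`, the mutual information satisfies
`I(X;T) ≤ H(X) - (p/2) log(2πe·p / (Φ(T|X) + J(X)))`.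
In particular, if `Φ(T|X)` is bounded above then so is `I(X;T)`. -/
theorem mutual_information_le_of_fisher
    (pd k : ℕ)
    (pXT : EuclideanSpace ℝ (Fin pd) → EuclideanSpace ℝ (Fin k) → ℝ)
    (hsmooth : ContDiff ℝ (⊤ : ℕ∞) (Function.uncurry pXT))
    (hpos : ∀ x t, 0 < pXT x t)
    (hprob : (∫ x, ∫ t, pXT x t) = 1)
    (pX : EuclideanSpace ℝ (Fin pd) → ℝ) (hpX : ∀ x, pX x = ∫ t, pXT x t)
    (hpXsm : ContDiff ℝ 1 pX)
    (pT : EuclideanSpace ℝ (Fin k) → ℝ) (hpT : ∀ t, pT t = ∫ x, pXT x t)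
    (HX JX Phi MI : ℝ)
    (hHX : HX = -∫ x, pX x * Real.log (pX x))
    (hHXfin : Integrable (fun x => pX x * Real.log (pX x)))
    (hJX : JX = ∫ x, ‖gradient (fun x' => Real.log (pX x')) x‖ ^ 2 * pX x)
    (hJXfin : Integrable (fun x => ‖gradient (fun x' => Real.log (pX x')) x‖ ^ 2 * pX x))
    (hPhi : Phi = ∫ x, ∫ t,
      ‖gradient (fun x' => Real.log (pXT x' t / pX x')) x‖ ^ 2 * pXT x t)
    (hPhifin : Integrable (Function.uncurry fun x t =>
      ‖gradient (fun x' => Real.log (pXT x' t / pX x')) x‖ ^ 2 * pXT x t))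
    (hMI : MI = ∫ x, ∫ t, pXT x t * Real.log (pXT x t / (pX x * pT t)))
    (hMIfin : Integrable (Function.uncurry fun x t =>
      pXT x t * Real.log (pXT x t / (pX x * pT t)))) :
    MI ≤ HX - (pd : ℝ) / 2 * Real.log (2 * π * Real.exp 1 * pd / (Phi + JX)) := by
  set h : EuclideanSpace ℝ (Fin pd) × EuclideanSpace ℝ (Fin k) → ℝ := Function.uncurry pXT with hdef
  have hsm : ContDiff ℝ 1 h := hsmooth.of_le (by exact_mod_cast le_top)
  have hh0 : ∀ z, 0 < h z := fun z => hpos z.1 z.2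
  have hpint : ∀ x, pX x = ∫ t, h (x, t) := hpX
  have hprob' : ∫ x, pX x = 1 := by simpa only [hpX] using hprob
  have hpXint : Integrable pX := by
    by_contra hn
    rw [integral_undef hn] at hprob'
    exact zero_ne_one hprob'
  have hpX0 : ∀ x, pX x ≠ 0 := by
    intro x
    rw [hpX]
    refine marginal_ne_zero hsm.continuous hpos ((funext hpX : pX = _) ▸ hpXsm.continuous) ?_ x
    by_contra! hz
    simp [hpX, hz] at hprob'
  have hpXpos : ∀ x, 0 < pX x := fun x =>
    ((hpX x).symm ▸ integral_nonneg fun t => (hpos x t).le : 0 ≤ pX x).lt_of_ne' (hpX0 x)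
  have hh : Integrable h (volume.prod volume) := by
    rw [integrable_prod_iff hsm.continuous.measurable.aestronglyMeasurable]
    refine ⟨Filter.Eventually.of_forall fun x => ?_, ?_⟩
    · by_contra hn
      exact hpX0 x ((hpint x).trans (integral_undef hn))
    · refine hpXint.congr (Filter.Eventually.of_forall fun x => ?_)
      simp only [Real.norm_of_nonneg (hh0 _).le, ← hpint]
  have hh1 : ∫ z, h z ∂(volume.prod volume) = 1 := by
    rw [integral_prod _ hh]
    exact hprob
  obtain ⟨hd, hsum⟩ := sum_integral_sq_fderiv_div hsm hh0 hh hpXsm hpint hpXpos hJXfin hPhifin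
  have hPhi' : Phi = ∫ z : EuclideanSpace ℝ (Fin pd) × EuclideanSpace ℝ (Fin k),
      ‖gradient (fun x' => Real.log (h (x', z.2) / pX x')) z.1‖ ^ 2 * h z
        ∂(volume.prod volume) :=
    hPhi.trans (integral_prod _ hPhifin).symm
  rw [← hPhi', ← hJX] at hsum
  have hTpos : ∀ᵐ z : EuclideanSpace ℝ (Fin pd) × EuclideanSpace ℝ (Fin k)
      ∂(volume.prod volume), 0 < pT z.2 := by
    refine Measure.quasiMeasurePreserving_snd.ae (p := fun t => 0 < pT t) ?_
    filter_upwards [hh.prod_left_ae] with t ht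
    rw [hpT]
    exact integral_pos_of_ae_pos (Filter.Eventually.of_forall fun x => hpos x t) ht
  obtain ⟨hHi, hHe⟩ := integrable_fst_mul_and_integral_eq (c := fun x => Real.log (pX x))
    (Real.measurable_log.comp hpXsm.continuous.measurable) (fun z => (hh0 z).le) hh hpint
    (by simpa only [mul_comm] using hHXfin)
  have hlog : ∀ᵐ z : EuclideanSpace ℝ (Fin pd) × EuclideanSpace ℝ (Fin k)
      ∂(volume.prod volume), pXT z.1 z.2 * Real.log (pXT z.1 z.2 / (pX z.1 * pT z.2))
        + Real.log (pX z.1) * h z = h z * Real.log (h z / ∫ x, h (x, z.2)) := by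
    filter_upwards [hTpos] with z hz
    have h1 := hpXpos z.1
    have h2 := hpos z.1 z.2
    change _ + Real.log (pX z.1) * pXT z.1 z.2
      = pXT z.1 z.2 * Real.log (pXT z.1 z.2 / ∫ x, pXT x z.2)
    rw [← hpT, Real.log_div h2.ne' (by positivity), Real.log_mul h1.ne' hz.ne',
      Real.log_div h2.ne' hz.ne']
    ring
  have hfL := (hMIfin.add hHi).congr hlog
  have hval : ∫ z, h z * Real.log (h z / ∫ x, h (x, z.2)) ∂(volume.prod volume) = MI - HX := by
    refine (integral_congr_ae hlog).symm.trans ((integral_add hMIfin hHi).trans ?_)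
    rw [hMI, hHX, sub_neg_eq_add]
    refine congrArg₂ (· + ·) (integral_prod _ hMIfin) (hHe.trans ?_)
    simp only [mul_comm]
  have hbound : ∀ s, 0 < s → MI - HX
      ≤ s / 2 * (Phi + JX) + pd * (-1 - Real.log (2 * π * s) / 2) := by
    intro s hs
    have := (hasEntropyBound_log_div_integral_euclidean hs hsm hh0 hh hd).2 hfL
    rwa [hval, hsum, hh1, mul_one] at this
  have hnonneg : 0 ≤ Phi + JX := by
    rw [← hsum]
    exact Finset.sum_nonneg fun i _ => integral_nonneg fun z => by have := hh0 z; positivity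
  have hzero : (pd : ℝ) = 0 → Phi + JX = 0 := by
    intro h0
    obtain rfl : pd = 0 := by exact_mod_cast h0
    simpa using hsum.symm
  have := le_neg_mul_log_of_forall_variance pd.cast_nonneg hnonneg hzero hbound
  linarith
end
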